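/- arXiv:0911.1285 — 4 statements merged into one kernel-verified Lean document; each statement's English description precedes it below -/
import Mathlib

section
/- (Algorithm Z, Zeilberger). Let r and s be nonnegative integers with r ≤ s. There is a bijection between the set of pairs of partitions (α, β), where α has s − r nonnegative parts and β has r nonnegative parts, and the set of pairs of partitions (μ, ν), where μ has s nonnegative parts and ν has r nonnegative parts each of size at most s − r, such that |α| + |β| = |μ| + |ν|. Equivalently, for every nonnegative integer N, the number of pairs (α, β) of the first kind with |α| + |β| = N equals the number of pairs (μ, ν) of the second kind with |μ| + |ν| = N. -/
open Cardinal in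
/-- Two subsets split into three pieces, each piece being an injective image, have the same
cardinality as soon as the sources of the pieces do. -/
theorem mk_union_image_congr {α : Type} {A₁ A₂ A₃ B₁ B₂ B₃ : Set α}
    {f₁ f₂ f₃ g₁ g₂ g₃ : α → α}
    (hf₁ : f₁.Injective) (hf₂ : f₂.Injective) (hf₃ : f₃.Injective)
    (hg₁ : g₁.Injective) (hg₂ : g₂.Injective) (hg₃ : g₃.Injective)
    (hA₁₂ : Disjoint (f₁ '' A₁) (f₂ '' A₂)) (hA₃ : Disjoint (f₁ '' A₁ ∪ f₂ '' A₂) (f₃ '' A₃))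
    (hB₁₂ : Disjoint (g₁ '' B₁) (g₂ '' B₂)) (hB₃ : Disjoint (g₁ '' B₁ ∪ g₂ '' B₂) (g₃ '' B₃))
    (h₁ : #A₁ = #B₁) (h₂ : #A₂ = #B₂) (h₃ : #A₃ = #B₃) :
    #(f₁ '' A₁ ∪ f₂ '' A₂ ∪ f₃ '' A₃ : Set α) = #(g₁ '' B₁ ∪ g₂ '' B₂ ∪ g₃ '' B₃ : Set α) := by
  rw [mk_union_of_disjoint hA₃, mk_union_of_disjoint hA₁₂, mk_union_of_disjoint hB₃,
    mk_union_of_disjoint hB₁₂, mk_image_eq hf₁, mk_image_eq hf₂, mk_image_eq hf₃,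
    mk_image_eq hg₁, mk_image_eq hg₂, mk_image_eq hg₃, h₁, h₂, h₃]

theorem Multiset.exists_eq_map_succ {s : Multiset ℕ} (h : 0 ∉ s) :
    ∃ t : Multiset ℕ, s = t.map Nat.succ := by
  refine ⟨s.map Nat.pred, ?_⟩
  rw [Multiset.map_map]
  conv_lhs => rw [← Multiset.map_id s]
  refine Multiset.map_congr rfl fun x hx => ?_
  have : x ≠ 0 := fun h0 => h (h0 ▸ hx)
  simp only [id, Function.comp]
  exact (Nat.succ_pred this).symm

theorem Multiset.sum_map_succ (s : Multiset ℕ) : (s.map Nat.succ).sum = s.sum + s.card := by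
  induction s using Multiset.induction_on with
  | empty => simp
  | cons a s ih => simp [ih]; omega

theorem Multiset.map_succ_ne_zero_cons (s t : Multiset ℕ) : s.map Nat.succ ≠ 0 ::ₘ t := by
  intro h
  simpa [← h] using Multiset.mem_cons_self 0 t

/-- Pairs of partitions with `m` and `r` nonnegative parts, of total weight `N`. -/
def freePairs (m r : ℕ) (N : ℤ) : Set (Multiset ℕ × Multiset ℕ) :=
  {p | p.1.card = m ∧ p.2.card = r ∧ ((p.1.sum + p.2.sum : ℕ) : ℤ) = N}

/-- Pairs of a partition with `m + r` nonnegative parts and a partition with `r` nonnegative parts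
each at most `m`, of total weight `N`. -/
def boxedPairs (m r : ℕ) (N : ℤ) : Set (Multiset ℕ × Multiset ℕ) :=
  {p | p.1.card = m + r ∧ p.2.card = r ∧ (∀ x ∈ p.2, x ≤ m) ∧
    ((p.1.sum + p.2.sum : ℕ) : ℤ) = N}

theorem freePairs_succ_succ (m r : ℕ) (N : ℤ) :
    freePairs (m + 1) (r + 1) N =
      (fun p => (0 ::ₘ p.1, p.2)) '' freePairs m (r + 1) N ∪
      (fun p => (p.1.map Nat.succ, 0 ::ₘ p.2)) '' freePairs (m + 1) r (N - (m + 1)) ∪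
      (fun p => (p.1.map Nat.succ, p.2.map Nat.succ)) ''
        freePairs (m + 1) (r + 1) (N - (m + 1) - (r + 1)) := by
  apply Set.Subset.antisymm
  · rintro ⟨a, b⟩ ⟨ha, hb, hN⟩
    by_cases h0 : 0 ∈ a
    · obtain ⟨a, rfl⟩ := Multiset.exists_cons_of_mem h0
      simp at ha hb hN
      exact Or.inl (Or.inl ⟨(a, b), ⟨ha, hb, by push_cast; omega⟩, rfl⟩)
    obtain ⟨a, rfl⟩ := Multiset.exists_eq_map_succ h0
    by_cases h1 : 0 ∈ b
    · obtain ⟨b, rfl⟩ := Multiset.exists_cons_of_mem h1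
      simp only [Multiset.card_map, Multiset.card_cons, Multiset.sum_map_succ,
        Multiset.sum_cons] at ha hb hN
      exact Or.inl (Or.inr ⟨(a, b), ⟨ha, by simpa using hb, by push_cast at *; omega⟩, rfl⟩)
    · obtain ⟨b, rfl⟩ := Multiset.exists_eq_map_succ h1
      simp only [Multiset.card_map, Multiset.sum_map_succ] at ha hb hN
      exact Or.inr ⟨(a, b), ⟨ha, hb, by push_cast at *; omega⟩, rfl⟩
  · rintro _ ((⟨⟨a, b⟩, ⟨ha, hb, hN⟩, rfl⟩ | ⟨⟨a, b⟩, ⟨ha, hb, hN⟩, rfl⟩) |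
      ⟨⟨a, b⟩, ⟨ha, hb, hN⟩, rfl⟩) <;>
    refine ⟨?_, ?_, ?_⟩ <;>
    simp only [Multiset.card_map, Multiset.card_cons, Multiset.sum_map_succ,
      Multiset.sum_cons] at ha hb hN ⊢ <;> push_cast at * <;> omega

theorem boxedPairs_succ_succ (m r : ℕ) (N : ℤ) :
    boxedPairs (m + 1) (r + 1) N =
      (fun p => (0 ::ₘ p.1, p.2)) '' boxedPairs m (r + 1) N ∪
      (fun p => (0 ::ₘ p.1, (m + 1) ::ₘ p.2)) '' boxedPairs (m + 1) r (N - (m + 1)) ∪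
      (fun p => (p.1.map Nat.succ, p.2)) ''
        boxedPairs (m + 1) (r + 1) (N - (m + 1) - (r + 1)) := by
  apply Set.Subset.antisymm
  · rintro ⟨a, b⟩ ⟨ha, hb, hle, hN⟩
    by_cases h0 : 0 ∈ a
    · obtain ⟨a, rfl⟩ := Multiset.exists_cons_of_mem h0
      by_cases h1 : m + 1 ∈ b
      · obtain ⟨b, rfl⟩ := Multiset.exists_cons_of_mem h1
        simp only [Multiset.card_cons, Multiset.sum_cons] at ha hb hN
        exact Or.inl (Or.inr ⟨(a, b), ⟨by simp only; omega, by simpa using hb,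
          fun x hx => hle x (Multiset.mem_cons_of_mem hx), by push_cast at *; omega⟩, rfl⟩)
      · simp only [Multiset.card_cons, Multiset.sum_cons] at ha hb hN
        refine Or.inl (Or.inl ⟨(a, b), ⟨by simp only; omega, hb, fun x hx => ?_,
          by push_cast at *; omega⟩, rfl⟩)
        have hne : x ≠ m + 1 := fun h => h1 (h ▸ hx)
        have := hle x hx
        omega
    · obtain ⟨a, rfl⟩ := Multiset.exists_eq_map_succ h0
      simp only [Multiset.card_map, Multiset.sum_map_succ] at ha hb hN
      exact Or.inr ⟨(a, b), ⟨ha, hb, hle, by push_cast at *; omega⟩, rfl⟩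
  · rintro _ ((⟨⟨a, b⟩, ⟨ha, hb, hle, hN⟩, rfl⟩ | ⟨⟨a, b⟩, ⟨ha, hb, hle, hN⟩, rfl⟩) |
      ⟨⟨a, b⟩, ⟨ha, hb, hle, hN⟩, rfl⟩) <;>
    simp only [] at ha hb hle hN <;>
    refine ⟨?_, ?_, ?_, ?_⟩ <;>
    simp only [Multiset.card_map, Multiset.card_cons, Multiset.sum_map_succ,
      Multiset.sum_cons, Multiset.mem_cons, forall_eq_or_imp, le_refl, true_and] <;>
    first
      | exact hle
      | exact fun x hx => (hle x hx).trans (Nat.le_succ m)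
      | (push_cast at *; omega)

open Cardinal in
theorem mk_freePairs_zero_left (r : ℕ) (N : ℤ) : #(freePairs 0 r N) = #(boxedPairs 0 r N) := by
  rw [Cardinal.eq]
  refine ⟨⟨fun p => ⟨(p.1.2, Multiset.replicate r 0), ?_⟩, fun p => ⟨(0, p.1.1), ?_⟩, ?_, ?_⟩⟩
  · obtain ⟨⟨a, b⟩, ha, hb, hN⟩ := p
    obtain rfl := Multiset.card_eq_zero.1 ha
    refine ⟨by simpa using hb, by simp, fun x hx => (Multiset.eq_of_mem_replicate hx).le, ?_⟩
    simpa using hN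
  · obtain ⟨⟨a, b⟩, ha, hb, hle, hN⟩ := p
    obtain rfl : b = Multiset.replicate r 0 :=
      Multiset.eq_replicate.2 ⟨hb, fun x hx => Nat.le_zero.1 (hle x hx)⟩
    exact ⟨rfl, by simpa using ha, by simpa using hN⟩
  · rintro ⟨⟨a, b⟩, ha, hb, hN⟩
    obtain rfl := Multiset.card_eq_zero.1 ha
    rfl
  · rintro ⟨⟨a, b⟩, ha, hb, hle, hN⟩
    obtain rfl : b = Multiset.replicate r 0 :=
      Multiset.eq_replicate.2 ⟨hb, fun x hx => Nat.le_zero.1 (hle x hx)⟩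
    rfl

theorem freePairs_zero_right (m : ℕ) (N : ℤ) : freePairs m 0 N = boxedPairs m 0 N := by
  ext ⟨a, b⟩
  constructor
  · rintro ⟨ha, hb, hN⟩
    obtain rfl := Multiset.card_eq_zero.1 hb
    exact ⟨ha, hb, by simp, hN⟩
  · rintro ⟨ha, hb, -, hN⟩
    exact ⟨ha, hb, hN⟩

open Cardinal in
theorem mk_freePairs (m r : ℕ) (N : ℤ) : #(freePairs m r N) = #(boxedPairs m r N) := by
  suffices h : ∀ (k : ℕ) (m r : ℕ) (N : ℤ), m + r + N < k →
      #(freePairs m r N) = #(boxedPairs m r N) from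
    h (m + r + N + 1).toNat m r N (by omega)
  intro k
  induction k with
  | zero =>
    intro m r N hk
    have h₁ : freePairs m r N = ∅ := by
      refine Set.eq_empty_of_forall_notMem ?_
      rintro p ⟨-, -, hN⟩
      omega
    have h₂ : boxedPairs m r N = ∅ := by
      refine Set.eq_empty_of_forall_notMem ?_
      rintro p ⟨-, -, -, hN⟩
      omega
    rw [h₁, h₂]
  | succ k ih =>
    intro m r N hk
    rcases m with _ | m
    · exact mk_freePairs_zero_left r N
    rcases r with _ | r
    · rw [freePairs_zero_right]
    have hmap := Multiset.map_injective Nat.succ_injective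
    rw [freePairs_succ_succ, boxedPairs_succ_succ]
    apply mk_union_image_congr
    · rintro ⟨a, b⟩ ⟨c, d⟩ h
      simpa using h
    · rintro ⟨a, b⟩ ⟨c, d⟩ h
      simpa [hmap.eq_iff] using h
    · rintro ⟨a, b⟩ ⟨c, d⟩ h
      simpa [hmap.eq_iff] using h
    · rintro ⟨a, b⟩ ⟨c, d⟩ h
      simpa using h
    · rintro ⟨a, b⟩ ⟨c, d⟩ h
      simpa using h
    · rintro ⟨a, b⟩ ⟨c, d⟩ h
      simpa [hmap.eq_iff] using h
    · rw [Set.disjoint_left]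
      rintro _ ⟨p, -, rfl⟩ ⟨q, -, hq⟩
      exact Multiset.map_succ_ne_zero_cons _ _ (Prod.ext_iff.1 hq).1
    · rw [Set.disjoint_left]
      rintro _ (⟨p, -, rfl⟩ | ⟨p, -, rfl⟩) ⟨q, -, hq⟩
      · exact Multiset.map_succ_ne_zero_cons _ _ (Prod.ext_iff.1 hq).1
      · exact Multiset.map_succ_ne_zero_cons _ _ (Prod.ext_iff.1 hq).2
    · rw [Set.disjoint_left]
      rintro _ ⟨p, ⟨-, -, hle, -⟩, rfl⟩ ⟨q, -, hq⟩
      have := hle (m + 1) ((Prod.ext_iff.1 hq).2 ▸ Multiset.mem_cons_self (m + 1) q.2)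
      omega
    · rw [Set.disjoint_left]
      rintro _ (⟨p, -, rfl⟩ | ⟨p, -, rfl⟩) ⟨q, -, hq⟩ <;>
      exact Multiset.map_succ_ne_zero_cons _ _ (Prod.ext_iff.1 hq).1
    all_goals
      apply ih
      push_cast at *
      omega

/-- **The Algorithm Z (Zeilberger).** For nonnegative integers `r ≤ s`, there is a
weight-preserving bijection between pairs of partitions `(α, β)` where `α` has `s - r`
nonnegative parts and `β` has `r` nonnegative parts, and pairs `(μ, ν)` where `μ` has `s`
nonnegative parts and `ν` has `r` nonnegative parts each at most `s - r`.
Partitions with a given number of nonnegative parts are modeled as multisets of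
natural numbers of the corresponding cardinality; the weight is the sum of the parts. -/
theorem algorithm_Z (r s : ℕ) (hrs : r ≤ s) :
    ∃ e : {p : Multiset ℕ × Multiset ℕ // p.1.card = s - r ∧ p.2.card = r} ≃
          {p : Multiset ℕ × Multiset ℕ //
            p.1.card = s ∧ p.2.card = r ∧ ∀ x ∈ p.2, x ≤ s - r},
      ∀ p, p.val.1.sum + p.val.2.sum = (e p).val.1.sum + (e p).val.2.sum := by
  let e (N : ℕ) := (Cardinal.eq.1 (mk_freePairs (s - r) r N)).some
  let fiberEquiv (N : ℕ) :
      {p : {p : Multiset ℕ × Multiset ℕ // p.1.card = s - r ∧ p.2.card = r} //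
        p.val.1.sum + p.val.2.sum = N} ≃
      {p : {p : Multiset ℕ × Multiset ℕ //
        p.1.card = s ∧ p.2.card = r ∧ ∀ x ∈ p.2, x ≤ s - r} //
        p.val.1.sum + p.val.2.sum = N} := by
    refine (Equiv.subtypeSubtypeEquivSubtypeInter _
      (fun p : Multiset ℕ × Multiset ℕ => p.1.sum + p.2.sum = N)).trans
      (Equiv.trans (Equiv.subtypeEquivRight fun p => ?_) ((e N).trans
      (Equiv.trans (Equiv.subtypeEquivRight fun p => ?_) (Equiv.subtypeSubtypeEquivSubtypeInter _
      (fun p : Multiset ℕ × Multiset ℕ => p.1.sum + p.2.sum = N)).symm)))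
    · simp only [freePairs, Set.mem_ofPred_eq, Nat.cast_inj, and_assoc]
    · simp only [boxedPairs, Set.mem_ofPred_eq, Nat.cast_inj, and_assoc, Nat.sub_add_cancel hrs]
  exact ⟨Equiv.ofFiberEquiv fiberEquiv, fun p => (Equiv.ofFiberEquiv_map fiberEquiv p).symm⟩
end

section
/- Let i and j be nonnegative integers. There is a bijection φ between the set of pairs of partitions (α, β), where α has i distinct nonnegative parts and β has j nonnegative parts, and the set of pairs of partitions (μ, ν), where μ has i + j nonnegative parts and ν has i distinct nonnegative parts each at most i + j − 1, such that |α| + |β| = |μ| + |ν|. Equivalently, for every nonnegative integer N, the number of pairs (α, β) of the first kind with total weight N equals the number of pairs (μ, ν) of the second kind with total weight N. -/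
namespace AlgorithmZ

/-- Adds one to every element of a finite set. -/
def shiftFinset (s : Finset ℕ) : Finset ℕ := s.map ⟨Nat.succ, Nat.succ_injective⟩

/-- Adds one to every element of a multiset. -/
def shiftMultiset (s : Multiset ℕ) : Multiset ℕ := s.map Nat.succ

lemma zero_notMem_shiftFinset (s : Finset ℕ) : 0 ∉ shiftFinset s := by
  simp [shiftFinset]

lemma zero_notMem_shiftMultiset (s : Multiset ℕ) : 0 ∉ shiftMultiset s := by
  simp [shiftMultiset]

lemma insert_zero_ne_shiftFinset (s t : Finset ℕ) : insert 0 s ≠ shiftFinset t :=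
  fun h => zero_notMem_shiftFinset t (h ▸ Finset.mem_insert_self 0 s)

lemma cons_zero_ne_shiftMultiset (s t : Multiset ℕ) : 0 ::ₘ s ≠ shiftMultiset t :=
  fun h => zero_notMem_shiftMultiset t (h ▸ Multiset.mem_cons_self 0 s)

lemma shiftFinset_injective : Function.Injective shiftFinset :=
  Finset.map_injective _

lemma shiftMultiset_injective : Function.Injective shiftMultiset :=
  Multiset.map_injective Nat.succ_injective

@[simp] lemma card_shiftFinset (s : Finset ℕ) : (shiftFinset s).card = s.card := by
  simp [shiftFinset]

@[simp] lemma card_shiftMultiset (s : Multiset ℕ) : (shiftMultiset s).card = s.card := by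
  simp [shiftMultiset]

@[simp] lemma sum_shiftFinset (s : Finset ℕ) :
    (shiftFinset s).sum id = s.sum id + s.card := by
  simp [shiftFinset, Finset.sum_add_distrib]

@[simp] lemma sum_shiftMultiset (s : Multiset ℕ) :
    (shiftMultiset s).sum = s.sum + s.card := by
  simp [shiftMultiset, Multiset.sum_map_add]

lemma exists_shiftFinset_eq {s : Finset ℕ} (h : 0 ∉ s) : ∃ t, shiftFinset t = s := by
  refine ⟨s.preimage Nat.succ Nat.succ_injective.injOn, ?_⟩
  ext x
  cases x <;> simp [shiftFinset, h]

lemma exists_shiftMultiset_eq {s : Multiset ℕ} (h : 0 ∉ s) : ∃ t, shiftMultiset t = s := by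
  refine ⟨s.map Nat.pred, ?_⟩
  rw [shiftMultiset, Multiset.map_map]
  conv_rhs => rw [← Multiset.map_id s]
  refine Multiset.map_congr rfl fun x hx => ?_
  exact Nat.succ_pred (ne_of_mem_of_not_mem hx h)

/-- Common codes for the pairs `(α, β)` with `n` parts in total and for the pairs `(μ, ν)` where
`μ` has `n` parts and `ν` is a set of numbers less than `n`. -/
inductive Code : ℕ → Type
  | nil : Code 0
  | zero {n : ℕ} : Code n → Code (n + 1)
  | mark {n : ℕ} : Code n → Code (n + 1)
  | shift {n : ℕ} : Code (n + 1) → Code (n + 1)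

namespace Code

/-- The pair `(α, β)` described by a code. -/
def source : {n : ℕ} → Code n → Finset ℕ × Multiset ℕ
  | _, nil => (∅, 0)
  | _, zero t => (t.source.1, 0 ::ₘ t.source.2)
  | _, mark t => (insert 0 (shiftFinset t.source.1), shiftMultiset t.source.2)
  | _, shift t => (shiftFinset t.source.1, shiftMultiset t.source.2)

/-- The pair `(μ, ν)` described by a code. -/
def target : {n : ℕ} → Code n → Multiset ℕ × Finset ℕ
  | _, nil => (0, ∅)
  | _, zero t => (0 ::ₘ t.target.1, t.target.2)
  | n + 1, mark t => (0 ::ₘ t.target.1, insert n t.target.2)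
  | _, shift t => (shiftMultiset t.target.1, t.target.2)

lemma card_source {n : ℕ} (t : Code n) : t.source.1.card + t.source.2.card = n := by
  induction t with
  | nil => simp [source]
  | zero t ih => simp [source]; omega
  | mark t ih =>
    simp [source, Finset.card_insert_of_notMem (zero_notMem_shiftFinset _)]; omega
  | shift t ih => simp [source]; omega

lemma card_target {n : ℕ} (t : Code n) : t.target.1.card = n := by
  induction t <;> simp_all [target]

lemma target_lt {n : ℕ} (t : Code n) : ∀ x ∈ t.target.2, x < n := by
  induction t with
  | nil => simp [target]
  | zero t ih => exact fun x hx => (ih x hx).trans (Nat.lt_succ_self _)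
  | mark t ih =>
    intro x hx
    rcases Finset.mem_insert.1 hx with rfl | hx
    · exact Nat.lt_succ_self _
    · exact (ih x hx).trans (Nat.lt_succ_self _)
  | shift t ih => exact ih

lemma notMem_target {n : ℕ} (t : Code n) : n ∉ t.target.2 :=
  fun h => lt_irrefl _ (t.target_lt n h)

lemma card_target_snd {n : ℕ} (t : Code n) : t.target.2.card = t.source.1.card := by
  induction t with
  | nil => rfl
  | zero t ih => exact ih
  | mark t ih =>
    simp [source, target, Finset.card_insert_of_notMem (zero_notMem_shiftFinset _),
      Finset.card_insert_of_notMem t.notMem_target, ih]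
  | shift t ih => simpa [source, target] using ih

lemma weight_eq {n : ℕ} (t : Code n) :
    t.source.1.sum id + t.source.2.sum = t.target.1.sum + t.target.2.sum id := by
  induction t with
  | nil => simp [source, target]
  | zero t ih => simpa [source, target] using ih
  | @mark n t ih =>
    have := t.card_source
    simp only [source, target]
    rw [Finset.sum_insert (zero_notMem_shiftFinset _), Finset.sum_insert t.notMem_target,
      sum_shiftFinset, sum_shiftMultiset, Multiset.sum_cons, id_eq, id_eq]
    change _ = _ + (n + t.target.2.sum id)
    omega
  | shift t ih =>
    have := t.card_source
    have := t.card_target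
    simp only [source, target, sum_shiftFinset, sum_shiftMultiset]
    omega

lemma source_injective {n : ℕ} : Function.Injective (source (n := n)) := by
  intro t
  induction t with
  | nil => intro u _; cases u; rfl
  | zero t ih =>
    intro u h
    cases u with
    | zero u =>
      simp only [source, Prod.mk.injEq, Multiset.cons_inj_right] at h
      rw [ih (Prod.ext h.1 h.2)]
    | mark u =>
      exact (cons_zero_ne_shiftMultiset _ _ (Prod.ext_iff.1 h).2).elim
    | shift u =>
      exact (cons_zero_ne_shiftMultiset _ _ (Prod.ext_iff.1 h).2).elim
  | mark t ih =>
    intro u h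
    cases u with
    | zero u =>
      exact (cons_zero_ne_shiftMultiset _ _ (Prod.ext_iff.1 h).2.symm).elim
    | mark u =>
      simp only [source, Prod.mk.injEq] at h
      have h₁ := congrArg (Finset.erase · 0) h.1
      simp only [Finset.erase_insert (zero_notMem_shiftFinset _)] at h₁
      rw [ih (Prod.ext (shiftFinset_injective h₁) (shiftMultiset_injective h.2))]
    | shift u =>
      exact (insert_zero_ne_shiftFinset _ _ (Prod.ext_iff.1 h).1).elim
  | shift t ih =>
    intro u h
    cases u with
    | zero u =>
      exact (cons_zero_ne_shiftMultiset _ _ (Prod.ext_iff.1 h).2.symm).elim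
    | mark u =>
      exact (insert_zero_ne_shiftFinset _ _ (Prod.ext_iff.1 h).1.symm).elim
    | shift u =>
      simp only [source, Prod.mk.injEq] at h
      rw [ih (Prod.ext (shiftFinset_injective h.1) (shiftMultiset_injective h.2))]

lemma target_injective {n : ℕ} : Function.Injective (target (n := n)) := by
  intro t
  induction t with
  | nil => intro u _; cases u; rfl
  | zero t ih =>
    intro u h
    cases u with
    | zero u =>
      simp only [target, Prod.mk.injEq, Multiset.cons_inj_right] at h
      rw [ih (Prod.ext h.1 h.2)]
    | mark u =>
      exact absurd ((Prod.ext_iff.1 h).2 ▸ Finset.mem_insert_self _ _) t.notMem_target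
    | shift u =>
      exact (cons_zero_ne_shiftMultiset _ _ (Prod.ext_iff.1 h).1).elim
  | @mark n t ih =>
    intro u h
    cases u with
    | zero u =>
      exact absurd ((Prod.ext_iff.1 h).2 ▸ Finset.mem_insert_self _ _) u.notMem_target
    | mark u =>
      simp only [target, Prod.mk.injEq, Multiset.cons_inj_right] at h
      have h₂ := congrArg (Finset.erase · n) h.2
      simp only [Finset.erase_insert t.notMem_target, Finset.erase_insert u.notMem_target] at h₂
      rw [ih (Prod.ext h.1 h₂)]
    | shift u =>
      exact (cons_zero_ne_shiftMultiset _ _ (Prod.ext_iff.1 h).1).elim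
  | shift t ih =>
    intro u h
    cases u with
    | zero u =>
      exact (cons_zero_ne_shiftMultiset _ _ (Prod.ext_iff.1 h).1.symm).elim
    | mark u =>
      exact (cons_zero_ne_shiftMultiset _ _ (Prod.ext_iff.1 h).1.symm).elim
    | shift u =>
      simp only [target, Prod.mk.injEq] at h
      rw [ih (Prod.ext (shiftMultiset_injective h.1) h.2)]

lemma exists_source_eq {n : ℕ} (a : Finset ℕ) (b : Multiset ℕ) (h : a.card + b.card = n) :
    ∃ t : Code n, t.source = (a, b) := by
  induction hw : n + (a.sum id + b.sum) using Nat.strong_induction_on generalizing n a b with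
  | _ w ih =>
    subst hw
    cases n with
    | zero =>
      obtain ⟨ha, hb⟩ : a = ∅ ∧ b = 0 := by simpa using h
      exact ⟨nil, by simp [source, ha, hb]⟩
    | succ n =>
      by_cases hb : 0 ∈ b
      · obtain ⟨b, rfl⟩ := Multiset.exists_cons_of_mem hb
        rw [Multiset.card_cons] at h
        obtain ⟨t, ht⟩ := ih _ (by simp) (n := n) a b (by omega) rfl
        exact ⟨zero t, by simp [source, ht]⟩
      · obtain ⟨b, rfl⟩ := exists_shiftMultiset_eq hb
        rw [card_shiftMultiset] at h
        by_cases ha : 0 ∈ a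
        · obtain ⟨a', ha'⟩ := exists_shiftFinset_eq (Finset.notMem_erase 0 a)
          obtain rfl : insert 0 (shiftFinset a') = a := by rw [ha', Finset.insert_erase ha]
          rw [Finset.card_insert_of_notMem (zero_notMem_shiftFinset _), card_shiftFinset] at h
          obtain ⟨t, ht⟩ := ih _ (by
            rw [Finset.sum_insert (zero_notMem_shiftFinset _), sum_shiftFinset, sum_shiftMultiset]
            omega) (n := n) a' b (by omega) rfl
          exact ⟨mark t, by simp [source, ht]⟩
        · obtain ⟨a, rfl⟩ := exists_shiftFinset_eq ha
          rw [card_shiftFinset] at h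
          obtain ⟨t, ht⟩ := ih _ (by
            rw [sum_shiftFinset, sum_shiftMultiset]
            omega) (n := n + 1) a b h rfl
          exact ⟨shift t, by simp [source, ht]⟩

lemma exists_target_eq {n : ℕ} (m : Multiset ℕ) (s : Finset ℕ) (hm : m.card = n)
    (hs : ∀ x ∈ s, x < n) : ∃ t : Code n, t.target = (m, s) := by
  induction hw : n + m.sum using Nat.strong_induction_on generalizing n m s with
  | _ w ih =>
    subst hw
    cases n with
    | zero =>
      have hs' : s = ∅ := Finset.eq_empty_of_forall_notMem fun x hx => by simpa using hs x hx
      exact ⟨nil, by simp [target, hs', Multiset.card_eq_zero.1 hm]⟩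
    | succ n =>
      by_cases h0 : 0 ∈ m
      · obtain ⟨m, rfl⟩ := Multiset.exists_cons_of_mem h0
        rw [Multiset.card_cons, Nat.succ_inj] at hm
        obtain ⟨t, ht⟩ := ih _ (by simp) (n := n) m (s.erase n) hm (fun x hx => by
          have := hs x (Finset.mem_of_mem_erase hx)
          have := Finset.ne_of_mem_erase hx
          omega) rfl
        by_cases hn : n ∈ s
        · exact ⟨mark t, by simp [target, ht, Finset.insert_erase hn]⟩
        · exact ⟨zero t, by simp [target, ht, Finset.erase_eq_of_notMem hn]⟩
      · obtain ⟨m, rfl⟩ := exists_shiftMultiset_eq h0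
        rw [card_shiftMultiset] at hm
        obtain ⟨t, ht⟩ := ih _ (by rw [sum_shiftMultiset]; omega) (n := n + 1) m s hm hs rfl
        exact ⟨shift t, by simp [target, ht]⟩

/-- Codes whose first set has `i` elements correspond to pairs `(α, β)`. -/
noncomputable def sourceEquiv (i j : ℕ) :
    {t : Code (i + j) // t.source.1.card = i} ≃
      {p : Finset ℕ × Multiset ℕ // p.1.card = i ∧ p.2.card = j} :=
  Equiv.ofBijective
    (fun t => ⟨t.1.source, t.2, by have := t.1.card_source; have := t.2; omega⟩)
    ⟨fun _ _ h => Subtype.ext (source_injective (congrArg Subtype.val h)), by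
      rintro ⟨⟨a, b⟩, ha, hb⟩
      obtain ⟨t, ht⟩ := exists_source_eq (n := i + j) a b (by simp_all)
      exact ⟨⟨t, by rw [ht]; exact ha⟩, Subtype.ext ht⟩⟩

/-- Codes whose first set has `i` elements correspond to pairs `(μ, ν)`. -/
noncomputable def targetEquiv (i j : ℕ) :
    {t : Code (i + j) // t.source.1.card = i} ≃
      {p : Multiset ℕ × Finset ℕ //
        p.1.card = i + j ∧ p.2.card = i ∧ ∀ x ∈ p.2, x < i + j} :=
  Equiv.ofBijective
    (fun t => ⟨t.1.target, t.1.card_target, t.1.card_target_snd.trans t.2, t.1.target_lt⟩)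
    ⟨fun _ _ h => Subtype.ext (target_injective (congrArg Subtype.val h)), by
      rintro ⟨⟨m, s⟩, hm, hs, hlt⟩
      obtain ⟨t, ht⟩ := exists_target_eq m s hm hlt
      exact ⟨⟨t, by rw [← t.card_target_snd, ht]; exact hs⟩, Subtype.ext ht⟩⟩

end Code

end AlgorithmZ


/-- There is a weight-preserving bijection `φ` between pairs of partitions `(α, β)`,
where `α` has `i` distinct nonnegative parts (modeled as a `Finset ℕ` of cardinality `i`)
and `β` has `j` nonnegative parts (modeled as a `Multiset ℕ` of cardinality `j`), and
pairs `(μ, ν)`, where `μ` has `i + j` nonnegative parts and `ν` has `i` distinct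
nonnegative parts each at most `i + j - 1` (i.e. `< i + j`). -/
theorem algorithm_Z_corollary (i j : ℕ) :
    ∃ e : {p : Finset ℕ × Multiset ℕ // p.1.card = i ∧ p.2.card = j} ≃
          {p : Multiset ℕ × Finset ℕ //
            p.1.card = i + j ∧ p.2.card = i ∧ ∀ x ∈ p.2, x < i + j},
      ∀ p, (p.val.1.sum id) + p.val.2.sum = (e p).val.1.sum + ((e p).val.2.sum id) := by
  refine ⟨(AlgorithmZ.Code.sourceEquiv i j).symm.trans (AlgorithmZ.Code.targetEquiv i j), ?_⟩
  intro p
  obtain ⟨t, rfl⟩ := (AlgorithmZ.Code.sourceEquiv i j).surjective p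
  rw [Equiv.trans_apply, Equiv.symm_apply_apply]
  exact t.1.weight_eq
end

section
/- (Variation of the Algorithm Z). Let s, t, k, m be nonnegative integers with s ≥ 1 and t ≥ 1. There is a bijection φ between the set of pairs of partitions (α, β), where α has s distinct parts each of size at least m and β has t nonnegative parts each of size at least k + s + t − 1, and the set of pairs of partitions (μ, ν), where μ = (μ₁ > μ₂ > … > μ_{s+t} ≥ 0) has s + t distinct nonnegative parts satisfying μ_s − μ_{s+1} ≥ m + 1, and ν has t distinct parts satisfying k ≤ ν_i ≤ k + s + t − 1 for each 1 ≤ i ≤ t, such that |α| + |β| = |μ| + |ν|. Equivalently, for every nonnegative integer N, the number of pairs (α, β) of the first kind with total weight N equals the number of pairs (μ, ν) of the second kind with total weight N. -/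
open Finset PowerSeries

/-- Every weight is attained by finitely many elements of `S`. -/
def FiniteFibers {α : Type*} (w : α → ℕ) (S : Set α) : Prop :=
  ∀ n, {x ∈ S | w x = n}.Finite

/-- The generating function `∑ x ∈ S, X ^ w x` (meaningful when `FiniteFibers w S`). -/
noncomputable def weightGenFun {α : Type*} (w : α → ℕ) (S : Set α) : ℤ⟦X⟧ :=
  PowerSeries.mk fun n => ({x ∈ S | w x = n}.ncard : ℤ)

section WeightGenFun

variable {α β : Type*} {w : α → ℕ} {w' : β → ℕ} {S S' : Set α} {T : Set β}

theorem FiniteFibers.mono (h : FiniteFibers w S) (hS : S' ⊆ S) : FiniteFibers w S' :=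
  fun n => (h n).subset fun _ hx => ⟨hS hx.1, hx.2⟩

theorem FiniteFibers.of_bijOn (h : FiniteFibers w S) {f : α → β} {c : ℕ}
    (hf : Set.BijOn f S T) (hw : ∀ x ∈ S, w' (f x) = w x + c) : FiniteFibers w' T := by
  intro n
  refine ((h (n - c)).image f).subset ?_
  rintro y ⟨hy, hyn⟩
  obtain ⟨x, hx, rfl⟩ := hf.surjOn hy
  have := hw x hx
  exact ⟨x, ⟨hx, by omega⟩, rfl⟩

theorem weightGenFun_of_bijOn {f : α → β} {c : ℕ}
    (hf : Set.BijOn f S T) (hw : ∀ x ∈ S, w' (f x) = w x + c) :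
    weightGenFun w' T = X ^ c * weightGenFun w S := by
  ext n
  rw [coeff_X_pow_mul']
  simp only [weightGenFun, coeff_mk]
  split_ifs with hc
  · have : {y ∈ T | w' y = n} = f '' {x ∈ S | w x = n - c} := by
      ext y
      constructor
      · rintro ⟨hy, hyn⟩
        obtain ⟨x, hx, rfl⟩ := hf.surjOn hy
        have := hw x hx
        exact ⟨x, ⟨hx, by omega⟩, rfl⟩
      · rintro ⟨x, ⟨hx, hxn⟩, rfl⟩
        have := hw x hx
        exact ⟨hf.mapsTo hx, by omega⟩
    rw [this, (hf.injOn.mono fun x hx => hx.1).ncard_image]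
  · have : {y ∈ T | w' y = n} = ∅ := by
      ext y
      simp only [Set.mem_ofPred_eq, Set.mem_empty_iff_false, iff_false, not_and]
      intro hy
      obtain ⟨x, hx, rfl⟩ := hf.surjOn hy
      have := hw x hx
      omega
    simp [this]

theorem weightGenFun_union (hS : FiniteFibers w S) (hS' : FiniteFibers w S')
    (hd : Disjoint S S') :
    weightGenFun w (S ∪ S') = weightGenFun w S + weightGenFun w S' := by
  ext n
  simp only [weightGenFun, coeff_mk, map_add]
  rw [← Nat.cast_add, ← Set.ncard_union_eq _ (hS n) (hS' n)]
  · congr 2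
    ext x
    simp only [Set.mem_ofPred_eq, Set.mem_union]
    tauto
  · exact hd.mono (fun x hx => hx.1) fun x hx => hx.1

theorem weightGenFun_empty : weightGenFun w ∅ = 0 := by
  ext n
  simp [weightGenFun]

theorem weightGenFun_singleton {a : α} (ha : w a = 0) : weightGenFun w {a} = 1 := by
  ext n
  simp only [weightGenFun, coeff_mk, coeff_one, Set.mem_singleton_iff]
  split_ifs with hn
  · have : {x | x = a ∧ w x = n} = {a} := by
      ext x
      simp only [Set.mem_ofPred_eq, Set.mem_singleton_iff, and_iff_left_iff_imp]
      rintro rfl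
      omega
    simp [this]
  · have : {x | x = a ∧ w x = n} = ∅ := by
      ext x
      simp only [Set.mem_ofPred_eq, Set.mem_empty_iff_false, iff_false, not_and]
      rintro rfl
      omega
    simp [this]

theorem FiniteFibers.prod (hS : FiniteFibers w S) (hT : FiniteFibers w' T) :
    FiniteFibers (fun p : α × β => w p.1 + w' p.2) (S ×ˢ T) := by
  intro n
  refine ((Set.finite_Iic n).biUnion fun i _ => (hS i).prod (hT (n - i))).subset ?_
  rintro ⟨x, y⟩ ⟨⟨hx, hy⟩, hn⟩
  simp only at hx hy hn
  simp only [Set.mem_iUnion, Set.mem_prod, Set.mem_ofPred_eq, Set.mem_Iic]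
  exact ⟨w x, by omega, ⟨hx, rfl⟩, hy, by omega⟩

theorem weightGenFun_prod (hS : FiniteFibers w S) (hT : FiniteFibers w' T) :
    weightGenFun (fun p : α × β => w p.1 + w' p.2) (S ×ˢ T)
      = weightGenFun w S * weightGenFun w' T := by
  classical
  ext n
  rw [coeff_mul]
  simp only [weightGenFun, coeff_mk]
  rw [Set.ncard_eq_toFinset_card _ (hS.prod hT n),
    Finset.card_eq_sum_card_fiberwise (f := fun p : α × β => (w p.1, w' p.2))
      (t := antidiagonal n)]
  · rw [Nat.cast_sum]
    refine Finset.sum_congr rfl ?_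
    rintro ⟨a, b⟩ hab
    rw [HasAntidiagonal.mem_antidiagonal] at hab
    simp only at hab ⊢
    rw [Set.ncard_eq_toFinset_card _ (hS a), Set.ncard_eq_toFinset_card _ (hT b),
      ← Nat.cast_mul, ← Finset.card_product]
    congr 2
    ext ⟨x, y⟩
    simp only [mem_filter, Set.Finite.mem_toFinset, Set.mem_ofPred_eq, Set.mem_prod,
      Prod.mk.injEq, mem_product]
    constructor
    · tauto
    · rintro ⟨⟨hx, rfl⟩, hy, rfl⟩
      tauto
  · rintro ⟨x, y⟩ h
    simpa using (((hS.prod hT n).mem_toFinset).1 h).2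

theorem exists_equiv_of_weightGenFun_eq (hS : FiniteFibers w S) (hT : FiniteFibers w' T)
    (h : weightGenFun w S = weightGenFun w' T) :
    ∃ e : S ≃ T, ∀ x : S, w x = w' (e x) := by
  have key : ∀ n, Nonempty ({x : S // w x = n} ≃ {y : T // w' y = n}) := by
    intro n
    have e₁ : {x : S // w x = n} ≃ {x ∈ S | w x = n} :=
      Equiv.subtypeSubtypeEquivSubtypeInter (· ∈ S) (w · = n)
    have e₂ : {y : T // w' y = n} ≃ {y ∈ T | w' y = n} :=
      Equiv.subtypeSubtypeEquivSubtypeInter (· ∈ T) (w' · = n)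
    have hc := congrArg (coeff n) h
    simp only [weightGenFun, coeff_mk, Nat.cast_inj] at hc
    have := (hS n).to_subtype
    have := (hT n).to_subtype
    exact ⟨e₁.trans (((Finite.card_eq.1 hc).some).trans e₂.symm)⟩
  let e := fun n => (key n).some
  refine ⟨(Equiv.sigmaFiberEquiv fun x : S => w x).symm.trans
    ((Equiv.sigmaCongrRight e).trans (Equiv.sigmaFiberEquiv fun y : T => w' y)), ?_⟩
  intro x
  exact (e (w x) ⟨x, rfl⟩).2.symm

end WeightGenFun

/-- The product `(1 - X)(1 - X ^ 2) ⋯ (1 - X ^ n)`. -/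
noncomputable def qFactorial (n : ℕ) : ℤ⟦X⟧ :=
  ∏ i ∈ range n, (1 - X ^ (i + 1))

theorem qFactorial_zero : qFactorial 0 = 1 := by
  simp [qFactorial]

theorem qFactorial_succ (n : ℕ) :
    qFactorial (n + 1) = qFactorial n * (1 - X ^ (n + 1)) :=
  prod_range_succ _ _

theorem qFactorial_ne_zero (n : ℕ) : qFactorial n ≠ 0 := by
  refine prod_ne_zero_iff.2 fun i _ h => ?_
  have := congrArg (coeff 0) h
  simp at this

theorem choose_two_succ (n : ℕ) : (n + 1).choose 2 = n + n.choose 2 := by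
  rw [Nat.choose_succ_succ' n 1, Nat.choose_one_right]

/-- Partitions into `s` distinct parts, each at least `m`. -/
def distinctParts (s m : ℕ) : Set (Finset ℕ) :=
  {p | p.card = s ∧ ∀ x ∈ p, m ≤ x}

theorem finiteFibers_distinctParts (s m : ℕ) :
    FiniteFibers (fun p : Finset ℕ => p.sum id) (distinctParts s m) := by
  intro n
  refine (range (n + 1)).powerset.finite_toSet.subset ?_
  rintro p ⟨-, hp⟩
  simp only [coe_powerset, Set.mem_preimage, Set.mem_powerset_iff, coe_subset]
  intro x hx
  have := single_le_sum (f := id) (fun _ _ => Nat.zero_le _) hx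
  exact mem_range.2 (Nat.lt_succ_of_le (this.trans hp.le))

theorem bijOn_map_succ_distinctParts (s m : ℕ) :
    Set.BijOn (Finset.map (addRightEmbedding 1)) (distinctParts s m)
      (distinctParts s (m + 1)) := by
  refine ⟨?_, (Finset.map_injective _).injOn, ?_⟩
  · rintro p ⟨hp, hm⟩
    refine ⟨by simpa using hp, ?_⟩
    simpa using hm
  · rintro p ⟨hp, hm⟩
    have h : (p.image (· - 1)).map (addRightEmbedding 1) = p := by
      ext x
      simp only [mem_map, mem_image, addRightEmbedding_apply]
      constructor
      · rintro ⟨_, ⟨a, ha, rfl⟩, rfl⟩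
        have := hm a ha
        rwa [Nat.sub_add_cancel (by omega)]
      · intro hx
        have := hm x hx
        exact ⟨x - 1, ⟨x, hx, rfl⟩, by omega⟩
    refine ⟨p.image (· - 1), ⟨?_, ?_⟩, h⟩
    · rw [← hp, ← card_map (addRightEmbedding 1), h]
    · intro x hx
      obtain ⟨a, ha, rfl⟩ := mem_image.1 hx
      have := hm a ha
      omega

theorem bijOn_insert_distinctParts (s m : ℕ) :
    Set.BijOn (insert m) (distinctParts s (m + 1))
      {p ∈ distinctParts (s + 1) m | m ∈ p} := by
  have hnot : ∀ p ∈ distinctParts s (m + 1), m ∉ p := fun p hp h => by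
    have := hp.2 m h
    omega
  refine ⟨?_, ?_, ?_⟩
  · intro p hp
    refine ⟨⟨by rw [card_insert_of_notMem (hnot p hp), hp.1], ?_⟩, mem_insert_self _ _⟩
    intro x hx
    rcases mem_insert.1 hx with rfl | hx
    · exact le_rfl
    · have := hp.2 x hx
      omega
  · intro p hp q hq h
    rw [← erase_insert (hnot p hp), ← erase_insert (hnot q hq), h]
  · rintro p ⟨⟨hp, hm⟩, hmp⟩
    refine ⟨p.erase m, ⟨by rw [card_erase_of_mem hmp, hp]; rfl, ?_⟩, insert_erase hmp⟩
    intro x hx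
    have := hm x (mem_of_mem_erase hx)
    have := ne_of_mem_erase hx
    omega

theorem weightGenFun_distinctParts (s m : ℕ) :
    weightGenFun (fun p : Finset ℕ => p.sum id) (distinctParts s m) * qFactorial s
      = X ^ (m * s + s.choose 2) := by
  have shift : ∀ s m, weightGenFun (fun p : Finset ℕ => p.sum id) (distinctParts s (m + 1))
      = X ^ s * weightGenFun (fun p : Finset ℕ => p.sum id) (distinctParts s m) :=
    fun s m => weightGenFun_of_bijOn (bijOn_map_succ_distinctParts s m) fun p hp => by
      simp [sum_add_distrib, hp.1]
  induction s with
  | zero =>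
    have : distinctParts 0 m = {∅} := by
      ext p
      simp only [distinctParts, Set.mem_ofPred_eq, card_eq_zero, Set.mem_singleton_iff,
        and_iff_left_iff_imp]
      rintro rfl
      simp
    rw [this, weightGenFun_singleton (by simp), qFactorial_zero]
    simp
  | succ s ih =>
    have split : distinctParts (s + 1) m
        = {p ∈ distinctParts (s + 1) m | m ∈ p} ∪ distinctParts (s + 1) (m + 1) := by
      ext p
      constructor
      · rintro ⟨hp, hm⟩
        by_cases h : m ∈ p
        · exact Or.inl ⟨⟨hp, hm⟩, h⟩
        · refine Or.inr ⟨hp, fun x hx => ?_⟩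
          have := hm x hx
          have : x ≠ m := fun h' => h (h' ▸ hx)
          omega
      · rintro (⟨h, -⟩ | ⟨hp, hm⟩)
        · exact h
        · exact ⟨hp, fun x hx => (Nat.le_succ m).trans (hm x hx)⟩
    have hrec := weightGenFun_union
      ((finiteFibers_distinctParts (s + 1) m).mono fun p hp => hp.1)
      (finiteFibers_distinctParts (s + 1) (m + 1))
      (Set.disjoint_left.2 fun (p : Finset ℕ) (hp : p ∈ {p ∈ distinctParts (s + 1) m | m ∈ p})
        hp' => absurd (hp'.2 m hp.2) (by omega))
    rw [← split, shift, weightGenFun_of_bijOn (w := fun p : Finset ℕ => p.sum id) (c := m)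
      (bijOn_insert_distinctParts s m), shift] at hrec
    · rw [qFactorial_succ, choose_two_succ, show m * (s + 1) + (s + s.choose 2)
        = m + s + (m * s + s.choose 2) by ring, pow_add X (m + s), ← ih]
      linear_combination (qFactorial s) * hrec
    · intro p hp
      have : m ∉ p := fun h => absurd (hp.2 m h) (by omega)
      rw [sum_insert this, id, add_comm]

/-- Partitions into `t` parts, each at least `k`. -/
def boundedParts (t k : ℕ) : Set (Multiset ℕ) :=
  {p | Multiset.card p = t ∧ ∀ x ∈ p, k ≤ x}

theorem finiteFibers_boundedParts (t k : ℕ) :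
    FiniteFibers Multiset.sum (boundedParts t k) := by
  intro n
  refine (Set.finite_Iic (t • Multiset.range (n + 1))).subset ?_
  rintro p ⟨⟨hp, -⟩, hn⟩
  rw [Set.mem_Iic, Multiset.le_iff_count]
  intro x
  by_cases hx : x ∈ p
  · have := Multiset.le_sum_of_mem hx
    rw [Multiset.count_nsmul, Multiset.count_eq_one_of_mem (Multiset.nodup_range _)
      (Multiset.mem_range.2 (by omega)), mul_one, ← hp]
    exact Multiset.count_le_card x p
  · rw [Multiset.count_eq_zero_of_notMem hx]
    exact Nat.zero_le _

theorem bijOn_map_succ_boundedParts (t k : ℕ) :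
    Set.BijOn (Multiset.map (· + 1)) (boundedParts t k) (boundedParts t (k + 1)) := by
  refine ⟨?_, (Multiset.map_injective (add_left_injective 1)).injOn, ?_⟩
  · rintro p ⟨hp, hk⟩
    refine ⟨by simpa using hp, ?_⟩
    simpa using hk
  · rintro p ⟨hp, hk⟩
    refine ⟨p.map (· - 1), ⟨by simpa using hp, ?_⟩, ?_⟩
    · intro x hx
      obtain ⟨a, ha, rfl⟩ := Multiset.mem_map.1 hx
      have := hk a ha
      omega
    · rw [Multiset.map_map]
      conv_rhs => rw [← Multiset.map_id p]
      refine Multiset.map_congr rfl fun x hx => ?_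
      have := hk x hx
      simp only [Function.comp, id]
      omega

theorem bijOn_cons_boundedParts (t k : ℕ) :
    Set.BijOn (Multiset.cons k) (boundedParts t k) {p ∈ boundedParts (t + 1) k | k ∈ p} := by
  refine ⟨?_, fun p _ q _ h => by simpa using h, ?_⟩
  · rintro p ⟨hp, hk⟩
    exact ⟨⟨by simpa using hp, by simpa using hk⟩, Multiset.mem_cons_self _ _⟩
  · rintro p ⟨⟨hp, hk⟩, hkp⟩
    exact ⟨p.erase k, ⟨by rw [Multiset.card_erase_of_mem hkp, hp]; rfl,
      fun x hx => hk x (Multiset.mem_of_mem_erase hx)⟩, Multiset.cons_erase hkp⟩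

theorem weightGenFun_boundedParts (t k : ℕ) :
    weightGenFun Multiset.sum (boundedParts t k) * qFactorial t = X ^ (k * t) := by
  induction t with
  | zero =>
    have : boundedParts 0 k = {0} := by
      ext p
      simp only [boundedParts, Set.mem_ofPred_eq, Multiset.card_eq_zero, Set.mem_singleton_iff,
        and_iff_left_iff_imp]
      rintro rfl
      simp
    rw [this, weightGenFun_singleton (by simp), qFactorial_zero]
    simp
  | succ t ih =>
    have split : boundedParts (t + 1) k
        = {p ∈ boundedParts (t + 1) k | k ∈ p} ∪ boundedParts (t + 1) (k + 1) := by
      ext p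
      constructor
      · rintro ⟨hp, hk⟩
        by_cases h : k ∈ p
        · exact Or.inl ⟨⟨hp, hk⟩, h⟩
        · refine Or.inr ⟨hp, fun x hx => ?_⟩
          have := hk x hx
          have : x ≠ k := fun h' => h (h' ▸ hx)
          omega
      · rintro (⟨h, -⟩ | ⟨hp, hk⟩)
        · exact h
        · exact ⟨hp, fun x hx => (Nat.le_succ k).trans (hk x hx)⟩
    have hrec := weightGenFun_union
      ((finiteFibers_boundedParts (t + 1) k).mono fun p hp => hp.1)
      (finiteFibers_boundedParts (t + 1) (k + 1))
      (Set.disjoint_left.2 fun (p : Multiset ℕ) (hp : p ∈ {p ∈ boundedParts (t + 1) k | k ∈ p})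
        hp' => absurd (hp'.2 k hp.2) (by omega))
    rw [← split, weightGenFun_of_bijOn (w := Multiset.sum) (c := t + 1)
      (bijOn_map_succ_boundedParts (t + 1) k), weightGenFun_of_bijOn (w := Multiset.sum) (c := k)
      (bijOn_cons_boundedParts t k)] at hrec
    · rw [qFactorial_succ, mul_add_one, pow_add X (k * t), ← ih]
      linear_combination (qFactorial t) * hrec
    · intro p _
      rw [Multiset.sum_cons, add_comm]
    · intro p hp
      rw [Multiset.sum_map_add, Multiset.map_id', Multiset.map_const', Multiset.sum_replicate, hp.1,
        smul_eq_mul, mul_one]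

/-- Partitions into `t` distinct parts, all in `[k, k + n)`. -/
def boxedParts (t k n : ℕ) : Set (Finset ℕ) :=
  {p | p.card = t ∧ ∀ x ∈ p, k ≤ x ∧ x < k + n}

theorem boxedParts_subset (t k n : ℕ) : boxedParts t k n ⊆ distinctParts t k :=
  fun _ hp => ⟨hp.1, fun x hx => (hp.2 x hx).1⟩

theorem finiteFibers_boxedParts (t k n : ℕ) :
    FiniteFibers (fun p : Finset ℕ => p.sum id) (boxedParts t k n) :=
  (finiteFibers_distinctParts t k).mono (boxedParts_subset t k n)

theorem bijOn_insert_boxedParts (t k n : ℕ) :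
    Set.BijOn (insert (k + n)) (boxedParts t k n)
      {p ∈ boxedParts (t + 1) k (n + 1) | k + n ∈ p} := by
  have hnot : ∀ p ∈ boxedParts t k n, k + n ∉ p := fun p hp h => by
    have := hp.2 _ h
    omega
  refine ⟨?_, ?_, ?_⟩
  · intro p hp
    refine ⟨⟨by rw [card_insert_of_notMem (hnot p hp), hp.1], ?_⟩, mem_insert_self _ _⟩
    intro x hx
    rcases mem_insert.1 hx with rfl | hx
    · omega
    · have := hp.2 x hx
      omega
  · intro p hp q hq h
    rw [← erase_insert (hnot p hp), ← erase_insert (hnot q hq), h]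
  · rintro p ⟨⟨hp, hm⟩, hmp⟩
    refine ⟨p.erase (k + n), ⟨by rw [card_erase_of_mem hmp, hp]; rfl, ?_⟩, insert_erase hmp⟩
    intro x hx
    have := hm x (mem_of_mem_erase hx)
    have := ne_of_mem_erase hx
    omega

theorem weightGenFun_boxedParts_succ (t k n : ℕ) :
    weightGenFun (fun p : Finset ℕ => p.sum id) (boxedParts (t + 1) k (n + 1))
      = X ^ (k + n) * weightGenFun (fun p : Finset ℕ => p.sum id) (boxedParts t k n)
        + weightGenFun (fun p : Finset ℕ => p.sum id) (boxedParts (t + 1) k n) := by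
  have split : boxedParts (t + 1) k (n + 1)
      = {p ∈ boxedParts (t + 1) k (n + 1) | k + n ∈ p} ∪ boxedParts (t + 1) k n := by
    ext p
    constructor
    · rintro ⟨hp, hm⟩
      by_cases h : k + n ∈ p
      · exact Or.inl ⟨⟨hp, hm⟩, h⟩
      · refine Or.inr ⟨hp, fun x hx => ?_⟩
        have := hm x hx
        have : x ≠ k + n := fun h' => h (h' ▸ hx)
        omega
    · rintro (⟨h, -⟩ | ⟨hp, hm⟩)
      · exact h
      · refine ⟨hp, fun x hx => ?_⟩
        have := hm x hx
        omega
  rw [split, weightGenFun_union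
      ((finiteFibers_boxedParts (t + 1) k (n + 1)).mono fun p hp => hp.1)
      (finiteFibers_boxedParts (t + 1) k n)
      (Set.disjoint_left.2 fun p hp hp' => absurd (hp'.2 _ hp.2) (by omega)),
    weightGenFun_of_bijOn (w := fun p : Finset ℕ => p.sum id) (c := k + n)
      (bijOn_insert_boxedParts t k n)]
  intro p hp
  have : k + n ∉ p := fun h => absurd (hp.2 _ h) (by omega)
  rw [sum_insert this, id, add_comm]

theorem boxedParts_zero (k n : ℕ) : boxedParts 0 k n = {∅} := by
  ext p
  simp only [boxedParts, Set.mem_ofPred_eq, card_eq_zero, Set.mem_singleton_iff,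
    and_iff_left_iff_imp]
  rintro rfl
  simp

theorem boxedParts_eq_empty {t k n : ℕ} (h : n < t) : boxedParts t k n = ∅ := by
  ext p
  simp only [Set.mem_empty_iff_false, iff_false]
  rintro ⟨hp, hm⟩
  have : p ⊆ Ico k (k + n) := fun x hx => mem_Ico.2 (hm x hx)
  have := card_le_card this
  rw [Nat.card_Ico] at this
  omega

theorem weightGenFun_boxedParts (t k j : ℕ) :
    weightGenFun (fun p : Finset ℕ => p.sum id) (boxedParts t k (t + j))
        * (qFactorial t * qFactorial j)
      = X ^ (k * t + t.choose 2) * qFactorial (t + j) := by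
  induction t generalizing j with
  | zero =>
    rw [boxedParts_zero, weightGenFun_singleton (by simp), qFactorial_zero]
    simp
  | succ t iht =>
    induction j with
    | zero =>
      have h := iht 0
      rw [qFactorial_zero, add_zero, mul_one] at h
      rw [qFactorial_zero, add_zero, weightGenFun_boxedParts_succ,
        boxedParts_eq_empty (Nat.lt_succ_self t), weightGenFun_empty, choose_two_succ,
        qFactorial_succ, show k * (t + 1) + (t + t.choose 2)
          = (k + t) + (k * t + t.choose 2) by ring, pow_add]
      linear_combination X ^ (k + t) * (1 - X ^ (t + 1)) * h
    | succ j ihj =>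
      have h := iht (j + 1)
      have e : t + 1 + j = t + (j + 1) := by omega
      rw [e, choose_two_succ, show k * (t + 1) + (t + t.choose 2)
          = (k + t) + (k * t + t.choose 2) by ring, pow_add] at ihj
      rw [← add_assoc (t + 1) j 1, e, weightGenFun_boxedParts_succ, choose_two_succ,
        qFactorial_succ (t + (j + 1)), show k * (t + 1) + (t + t.choose 2)
          = (k + t) + (k * t + t.choose 2) by ring, pow_add X (k + t)]
      rw [qFactorial_succ t] at ihj ⊢
      rw [qFactorial_succ j] at h ⊢
      linear_combination (1 - X ^ (j + 1)) * ihj + X ^ (k + (t + (j + 1))) * (1 - X ^ (t + 1)) * h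

/-- Strictly decreasing sequences of length `n`. -/
def strictAntiSeqs (n : ℕ) : Set (Fin n → ℕ) :=
  {f | StrictAnti f}

theorem bijOn_image_strictAntiSeqs (n : ℕ) :
    Set.BijOn (fun f : Fin n → ℕ => univ.image f) (strictAntiSeqs n) (distinctParts n 0) := by
  refine ⟨?_, ?_, ?_⟩
  · intro f hf
    exact ⟨by rw [card_image_of_injective _ (StrictAnti.injective hf), card_fin],
      fun _ _ => Nat.zero_le _⟩
  · intro f hf g hg h
    have := congrArg (fun p : Finset ℕ => (p : Set ℕ)) h
    simp only [coe_image, coe_univ, Set.image_univ] at this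
    exact (StrictAnti.range_inj hf hg).1 this
  · rintro p ⟨hp, -⟩
    refine ⟨fun i => p.orderEmbOfFin hp i.rev, ?_, ?_⟩
    · intro i j hij
      exact (p.orderEmbOfFin hp).strictMono (Fin.rev_lt_rev.2 hij)
    · rw [← coe_inj]
      simp only [coe_image, coe_univ, Set.image_univ]
      rw [← p.range_orderEmbOfFin hp]
      exact Fin.rev_surjective.range_comp (p.orderEmbOfFin hp)

theorem finiteFibers_strictAntiSeqs (n : ℕ) :
    FiniteFibers (fun f : Fin n → ℕ => ∑ i, f i) (strictAntiSeqs n) := by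
  intro N
  refine (Set.Finite.pi' fun _ : Fin n => Set.finite_Iic N).subset ?_
  rintro f ⟨-, hf⟩ i
  rw [Set.mem_Iic, ← hf]
  exact single_le_sum (f := f) (fun _ _ => Nat.zero_le _) (mem_univ i)

theorem weightGenFun_strictAntiSeqs (n : ℕ) :
    weightGenFun (fun f : Fin n → ℕ => ∑ i, f i) (strictAntiSeqs n) * qFactorial n
      = X ^ n.choose 2 := by
  have h := weightGenFun_distinctParts n 0
  rw [weightGenFun_of_bijOn (w := fun f : Fin n → ℕ => ∑ i, f i) (c := 0)
    (bijOn_image_strictAntiSeqs n)] at h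
  · simpa using h
  · intro f hf
    rw [sum_image (StrictAnti.injective hf).injOn]
    rfl

/-- Strictly decreasing sequences of length `s + t` whose first `s` terms exceed the others by at
least `m + 1`. -/
def gappedSeqs (s t m : ℕ) : Set (Fin (s + t) → ℕ) :=
  {f | StrictAnti f ∧ ∀ i j : Fin (s + t), i.val < s → s ≤ j.val → f j + (m + 1) ≤ f i}

theorem mem_gappedSeqs_iff {s t m : ℕ} {f : Fin (s + t) → ℕ} {i j : Fin (s + t)}
    (hi : i.val + 1 = s) (hj : j.val = s) :
    f ∈ gappedSeqs s t m ↔ StrictAnti f ∧ f j + (m + 1) ≤ f i := by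
  refine and_congr_right fun hf => ⟨fun h => h i j (by omega) hj.ge, fun h a b ha hb => ?_⟩
  have h₁ : f i ≤ f a := hf.antitone (Fin.le_def.2 (by omega))
  have h₂ : f b ≤ f j := hf.antitone (Fin.le_def.2 (by omega))
  omega

theorem bijOn_add_gappedSeqs (s t m : ℕ) (ht : 1 ≤ t) :
    Set.BijOn (fun (f : Fin (s + t) → ℕ) i => f i + if i.val < s then m else 0)
      (strictAntiSeqs (s + t)) (gappedSeqs s t m) := by
  refine ⟨?_, ?_, ?_⟩
  · intro f hf
    refine ⟨fun i j hij => ?_, fun i j hi hj => ?_⟩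
    · have := hf hij
      have : i.val < j.val := hij
      simp only
      split_ifs <;> omega
    · have : f j < f i := hf (Fin.lt_def.2 (by omega))
      simp only [if_pos hi, if_neg hj.not_gt]
      omega
  · intro f _ g _ h
    funext i
    exact Nat.add_right_cancel (congrFun h i)
  · rintro f ⟨hf, hgap⟩
    have hle : ∀ i : Fin (s + t), i.val < s → m ≤ f i := fun i hi => by
      have := hgap i ⟨s, by omega⟩ hi le_rfl
      omega
    refine ⟨fun i => f i - if i.val < s then m else 0, fun i j hij => ?_, ?_⟩
    · have h₁ := hf hij
      have h₂ : i.val < j.val := hij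
      simp only
      split_ifs with hj hi hi
      · have := hle j hj
        omega
      · omega
      · have := hgap i j hi (by omega)
        omega
      · omega
    · funext i
      simp only
      split_ifs with hi
      · have := hle i hi
        omega
      · rfl

theorem sum_add_ite_lt (s t m : ℕ) (f : Fin (s + t) → ℕ) :
    ∑ i, (f i + if i.val < s then m else 0) = ∑ i, f i + m * s := by
  rw [sum_add_distrib, Fin.sum_univ_add (fun i : Fin (s + t) => if i.val < s then m else 0)]
  simp [mul_comm]

theorem finiteFibers_gappedSeqs (s t m : ℕ) :
    FiniteFibers (fun f : Fin (s + t) → ℕ => ∑ i, f i) (gappedSeqs s t m) :=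
  (finiteFibers_strictAntiSeqs (s + t)).mono fun _ hf => hf.1

theorem weightGenFun_gappedSeqs (s t m : ℕ) (ht : 1 ≤ t) :
    weightGenFun (fun f : Fin (s + t) → ℕ => ∑ i, f i) (gappedSeqs s t m)
        * qFactorial (s + t)
      = X ^ (m * s + (s + t).choose 2) := by
  rw [weightGenFun_of_bijOn (bijOn_add_gappedSeqs s t m ht)
    fun f _ => sum_add_ite_lt s t m f, mul_assoc, weightGenFun_strictAntiSeqs, pow_add]

theorem choose_two_add_exponent (s t k : ℕ) :
    (s + (t + 1)).choose 2 + (k * (t + 1) + (t + 1).choose 2)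
      = s.choose 2 + (k + s + t) * (t + 1) := by
  induction t with
  | zero => simp [choose_two_succ]; ring
  | succ t ih =>
    rw [← add_assoc s, choose_two_succ (s + (t + 1)), choose_two_succ (t + 1)]
    linear_combination ih

/-- **Variation of the Algorithm Z.** Let `s, t, k, m` be nonnegative integers with
`s ≥ 1` and `t ≥ 1`. There is a weight-preserving bijection between pairs `(α, β)`,
where `α` has `s` distinct parts each at least `m` (a `Finset ℕ` of cardinality `s`) and
`β` has `t` parts each at least `k + s + t - 1` (a `Multiset ℕ` of cardinality `t`), and
pairs `(μ, ν)`, where `μ = (μ₁ > ⋯ > μ_{s+t} ≥ 0)` has `s + t` distinct nonnegative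
parts (a strictly decreasing function `Fin (s+t) → ℕ`, zero-indexed) with
`μ_s - μ_{s+1} ≥ m + 1`, and `ν` has `t` distinct parts with `k ≤ νᵢ ≤ k + s + t - 1`. -/
theorem algorithm_Z_variation (s t k m : ℕ) (hs : 1 ≤ s) (ht : 1 ≤ t) :
    ∃ e : {p : Finset ℕ × Multiset ℕ //
            p.1.card = s ∧ (∀ x ∈ p.1, m ≤ x) ∧
            p.2.card = t ∧ (∀ x ∈ p.2, k + s + t - 1 ≤ x)} ≃
          {p : (Fin (s + t) → ℕ) × Finset ℕ //
            StrictAnti p.1 ∧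
            p.1 ⟨s, by omega⟩ + (m + 1) ≤ p.1 ⟨s - 1, by omega⟩ ∧
            p.2.card = t ∧ (∀ x ∈ p.2, k ≤ x ∧ x ≤ k + s + t - 1)},
      ∀ p, (p.val.1.sum id) + p.val.2.sum
          = (∑ i, (e p).val.1 i) + ((e p).val.2.sum id) := by
  have hbox : ∀ p : Finset ℕ, (∀ x ∈ p, k ≤ x ∧ x ≤ k + s + t - 1) ↔
      ∀ x ∈ p, k ≤ x ∧ x < k + (t + s) := fun p =>
    forall₂_congr fun x _ => by omega
  have hgf : weightGenFun (fun p : Finset ℕ × Multiset ℕ => p.1.sum id + p.2.sum)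
        (distinctParts s m ×ˢ boundedParts t (k + s + t - 1))
      = weightGenFun (fun p : (Fin (s + t) → ℕ) × Finset ℕ => ∑ i, p.1 i + p.2.sum id)
        (gappedSeqs s t m ×ˢ boxedParts t k (t + s)) := by
    rw [weightGenFun_prod (finiteFibers_distinctParts _ _) (finiteFibers_boundedParts _ _),
      weightGenFun_prod (finiteFibers_gappedSeqs _ _ _) (finiteFibers_boxedParts _ _ _)]
    have hA := weightGenFun_distinctParts s m
    have hB := weightGenFun_boundedParts t (k + s + t - 1)
    have hM := weightGenFun_gappedSeqs s t m ht
    have hD := weightGenFun_boxedParts t k s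
    have hexp : (X : ℤ⟦X⟧) ^ (m * s + s.choose 2) * X ^ ((k + s + t - 1) * t)
        = X ^ (m * s + (s + t).choose 2) * X ^ (k * t + t.choose 2) := by
      obtain ⟨u, rfl⟩ := Nat.exists_eq_add_of_le' ht
      rw [← pow_add, ← pow_add, add_assoc, add_assoc (m * s), choose_two_add_exponent]
      rfl
    rw [← hA, ← hB, ← hM] at hexp
    rw [add_comm t s] at hD ⊢
    refine mul_right_cancel₀ (mul_ne_zero (qFactorial_ne_zero s) (qFactorial_ne_zero t)) ?_
    linear_combination hexp - weightGenFun (fun f : Fin (s + t) → ℕ => ∑ i, f i)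
      (gappedSeqs s t m) * hD
  obtain ⟨e, he⟩ := exists_equiv_of_weightGenFun_eq
    ((finiteFibers_distinctParts s m).prod (finiteFibers_boundedParts t (k + s + t - 1)))
    ((finiteFibers_gappedSeqs s t m).prod (finiteFibers_boxedParts t k (t + s))) hgf
  have hpair : ∀ p : Finset ℕ × Multiset ℕ, (p.1.card = s ∧ (∀ x ∈ p.1, m ≤ x) ∧
      p.2.card = t ∧ ∀ x ∈ p.2, k + s + t - 1 ≤ x) ↔
      p ∈ distinctParts s m ×ˢ boundedParts t (k + s + t - 1) :=
    fun _ => and_assoc.symm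
  refine ⟨(Equiv.subtypeEquivRight hpair).trans
    (e.trans (Equiv.subtypeEquivRight fun p => ?_)), fun p => he (Equiv.subtypeEquivRight hpair p)⟩
  rw [hbox, Set.mem_prod, mem_gappedSeqs_iff (i := ⟨s - 1, by omega⟩) (j := ⟨s, by omega⟩)
    (Nat.sub_add_cancel hs) rfl]
  exact and_assoc
end

section
/- Fix an integer N ≥ 0. Let 𝒜 be the set of quintuples (n; α, β, γ, λ, μ) where n is a nonnegative integer, α is a partition into distinct positive parts, β is a partition into positive parts, γ is a partition into distinct nonnegative parts, λ is a partition into distinct nonnegative parts each at most n − 1, μ is a partition into nonnegative parts each at most n − 1, and n − l(γ) = N. Let ℬ be the set of quintuples (A, B, C, D, E) where A and C are partitions into distinct nonnegative parts, B and D are partitions into nonnegative parts, E is a partition into distinct positive parts, and l(C) + l(D) − l(E) = N. Then there is a bijection from 𝒜 to ℬ, sending (n; α, β, γ, λ, μ) to (A, B, C, D, E), such that |α| + |β| + |γ| + |λ| + |μ| = |A| + |B| + |C| + |D| + |E|, l(λ) − l(α) − l(γ) = l(C) − l(A) − l(E), and l(γ) + l(μ) = l(A) + l(B). -/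
/-- A quintuple `(n; α, β, γ, λ, μ)` in the set `𝒜`: `n : ℕ`, `α` a partition into
distinct positive parts, `β` a partition into positive parts, `γ` a partition into
distinct nonnegative parts, `λ` a partition into distinct nonnegative parts each at
most `n - 1`, `μ` a partition into nonnegative parts each at most `n - 1`, with
`n - l(γ) = N` (in `ℤ`). -/
structure RamanujanTupleA (N : ℤ) where
  n : ℕ
  α : Finset ℕ
  β : Multiset ℕ
  γ : Finset ℕ
  lam : Finset ℕ
  μ : Multiset ℕ
  hα : ∀ x ∈ α, 0 < x
  hβ : ∀ x ∈ β, 0 < x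
  hlam : ∀ x ∈ lam, x + 1 ≤ n
  hμ : ∀ x ∈ μ, x + 1 ≤ n
  hN : (n : ℤ) - γ.card = N

/-- A quintuple `(A, B, C, D, E)` in the set `ℬ`: `A` and `C` partitions into distinct
nonnegative parts, `B` and `D` partitions into nonnegative parts, `E` a partition into
distinct positive parts, with `l(C) + l(D) - l(E) = N` (in `ℤ`). -/
structure RamanujanTupleB (N : ℤ) where
  A : Finset ℕ
  B : Multiset ℕ
  C : Finset ℕ
  D : Multiset ℕ
  E : Finset ℕ
  hE : ∀ x ∈ E, 0 < x
  hN : (C.card : ℤ) + D.card - E.card = N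

/-- A set `{x | P x}` generated freely, up to the relation `s x₀ = x₀`, from a point `x₀` by two
operations `op true`, `op false` and a step `s`: every element is uniquely of the form
`s^[t₁] (op b₁ (s^[t₂] (op b₂ ⋯ x₀)))`. -/
structure WordSystem {X : Type} (P : X → Prop) where
  base : X
  op : Bool → X → X
  step : X → X
  size : X → ℕ
  base_mem : P base
  op_mem : ∀ b x, P x → P (op b x)
  step_mem : ∀ x, P x → P (step x)
  step_base : step base = base
  op_inj : ∀ b c x y, P x → P y → op b x = op c y → b = c ∧ x = y
  step_inj : ∀ x y, P x → P y → step x = step y → x = y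
  op_ne_base : ∀ b x, P x → op b x ≠ base
  op_ne_step : ∀ b x y, P x → P y → op b x ≠ step y
  cases_mem : ∀ x, P x → x = base ∨ (∃ b y, P y ∧ op b y = x ∧ size y < size x) ∨
    ∃ y, P y ∧ step y = x ∧ size y < size x

namespace WordSystem

variable {X Y : Type} {P : X → Prop} {Q : Y → Prop}

/-- The element spelled by a word. -/
def eval (S : WordSystem P) : List (Bool × ℕ) → X
  | [] => S.base
  | (b, t) :: w => S.step^[t] (S.op b (S.eval w))

theorem iterate_step_mem (S : WordSystem P) {x : X} (hx : P x) (t : ℕ) : P (S.step^[t] x) := by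
  induction t with
  | zero => exact hx
  | succ t ih => rw [Function.iterate_succ_apply']; exact S.step_mem _ ih

theorem eval_mem (S : WordSystem P) : ∀ w, P (S.eval w)
  | [] => S.base_mem
  | (b, t) :: w => S.iterate_step_mem (S.op_mem b _ (S.eval_mem w)) t

theorem iterate_step_op_ne_base (S : WordSystem P) (b : Bool) {x : X} (hx : P x) (t : ℕ) :
    S.step^[t] (S.op b x) ≠ S.base := by
  induction t with
  | zero => exact S.op_ne_base b x hx
  | succ t ih =>
    rw [Function.iterate_succ_apply']
    intro h
    rw [← S.step_base] at h
    exact ih (S.step_inj _ _ (S.iterate_step_mem (S.op_mem b x hx) t) S.base_mem h)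

theorem iterate_step_op_inj (S : WordSystem P) {b c : Bool} {x y : X} (hx : P x) (hy : P y)
    (t u : ℕ) (h : S.step^[t] (S.op b x) = S.step^[u] (S.op c y)) : b = c ∧ t = u ∧ x = y := by
  induction t generalizing u with
  | zero =>
    cases u with
    | zero =>
      obtain ⟨h₁, h₂⟩ := S.op_inj _ _ _ _ hx hy h
      exact ⟨h₁, rfl, h₂⟩
    | succ u =>
      rw [Function.iterate_succ_apply'] at h
      exact absurd h (S.op_ne_step _ _ _ hx (S.iterate_step_mem (S.op_mem _ _ hy) u))
  | succ t ih =>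
    cases u with
    | zero =>
      rw [Function.iterate_succ_apply'] at h
      exact absurd h.symm (S.op_ne_step _ _ _ hy (S.iterate_step_mem (S.op_mem _ _ hx) t))
    | succ u =>
      rw [Function.iterate_succ_apply', Function.iterate_succ_apply'] at h
      obtain ⟨h₁, h₂, h₃⟩ := ih u (S.step_inj _ _ (S.iterate_step_mem (S.op_mem _ _ hx) t)
        (S.iterate_step_mem (S.op_mem _ _ hy) u) h)
      exact ⟨h₁, congrArg _ h₂, h₃⟩

theorem eval_injective (S : WordSystem P) : Function.Injective S.eval
  | [], [], _ => rfl
  | [], (b, t) :: w, h => absurd h.symm (S.iterate_step_op_ne_base b (S.eval_mem w) t)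
  | (b, t) :: w, [], h => absurd h (S.iterate_step_op_ne_base b (S.eval_mem w) t)
  | (b, t) :: w, (c, u) :: v, h => by
    obtain ⟨h₁, h₂, h₃⟩ := S.iterate_step_op_inj (S.eval_mem w) (S.eval_mem v) t u h
    rw [h₁, h₂, S.eval_injective h₃]

theorem exists_eval_eq (S : WordSystem P) {x : X} (hx : P x) : ∃ w, S.eval w = x := by
  induction h : S.size x using Nat.strong_induction_on generalizing x with
  | _ k ih =>
    subst h
    obtain rfl | ⟨b, y, hy, rfl, hlt⟩ | ⟨y, hy, rfl, hlt⟩ := S.cases_mem x hx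
    · exact ⟨[], rfl⟩
    · obtain ⟨w, rfl⟩ := ih _ hlt hy rfl
      exact ⟨(b, 0) :: w, rfl⟩
    · obtain ⟨w, rfl⟩ := ih _ hlt hy rfl
      match w with
      | [] => exact ⟨[], S.step_base.symm⟩
      | (b, t) :: w => exact ⟨(b, t + 1) :: w, Function.iterate_succ_apply' _ _ _⟩

/-- Words are in bijection with the elements they spell. -/
noncomputable def evalEquiv (S : WordSystem P) : List (Bool × ℕ) ≃ {x // P x} :=
  Equiv.ofBijective (fun w ↦ ⟨S.eval w, S.eval_mem w⟩)
    ⟨fun _ _ h ↦ S.eval_injective (congrArg Subtype.val h),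
      fun x ↦ (S.exists_eval_eq x.2).imp fun _ h ↦ Subtype.ext h⟩

/-- Two word systems are in bijection by a map whose graph is contained in any relation
compatible with the operations. -/
theorem exists_equiv (S : WordSystem P) (T : WordSystem Q) (R : X → Y → Prop)
    (h_base : R S.base T.base)
    (h_op : ∀ b x y, P x → Q y → R x y → R (S.op b x) (T.op b y))
    (h_step : ∀ x y, P x → Q y → R x y → R (S.step x) (T.step y)) :
    ∃ e : {x // P x} ≃ {y // Q y}, ∀ x : {x // P x}, R x (e x) := by
  have key : ∀ w, R (S.eval w) (T.eval w) := by
    intro w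
    induction w with
    | nil => exact h_base
    | cons a w ih =>
      obtain ⟨b, t⟩ := a
      change R (S.step^[t] _) (T.step^[t] _)
      induction t with
      | zero => exact h_op _ _ _ (S.eval_mem w) (T.eval_mem w) ih
      | succ t iht =>
        rw [Function.iterate_succ_apply', Function.iterate_succ_apply']
        exact h_step _ _ (S.iterate_step_mem (S.op_mem _ _ (S.eval_mem w)) t)
          (T.iterate_step_mem (T.op_mem _ _ (T.eval_mem w)) t) iht
  refine ⟨S.evalEquiv.symm.trans T.evalEquiv, fun x ↦ ?_⟩
  obtain ⟨w, rfl⟩ := S.evalEquiv.surjective x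
  rw [Equiv.trans_apply, Equiv.symm_apply_apply]
  exact key w

end WordSystem

namespace Finset

/-- The set of all `x + k` with `x ∈ s`. -/
def shift (k : ℕ) (s : Finset ℕ) : Finset ℕ := s.map (addRightEmbedding k)

theorem mem_shift {k x : ℕ} {s : Finset ℕ} : x ∈ s.shift k ↔ ∃ y ∈ s, y + k = x := by
  simp [shift]

theorem card_shift (k : ℕ) (s : Finset ℕ) : (s.shift k).card = s.card := card_map _

theorem sum_shift (k : ℕ) (s : Finset ℕ) : (s.shift k).sum id = s.sum id + s.card * k := by
  simp [shift, sum_add_distrib]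

theorem shift_injective (k : ℕ) : Function.Injective (shift k) := map_injective _

theorem zero_notMem_shift_one (s : Finset ℕ) : 0 ∉ s.shift 1 := by
  simp [mem_shift]

theorem exists_shift_eq {k : ℕ} {s : Finset ℕ} (h : ∀ x ∈ s, k ≤ x) : ∃ r, shift k r = s := by
  refine ⟨s.image (· - k), ?_⟩
  ext x
  simp only [mem_shift, mem_image]
  constructor
  · rintro ⟨_, ⟨y, hy, rfl⟩, rfl⟩
    rwa [Nat.sub_add_cancel (h y hy)]
  · intro hx
    exact ⟨_, ⟨x, hx, rfl⟩, Nat.sub_add_cancel (h x hx)⟩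

theorem exists_shift_one_eq {s : Finset ℕ} (h : 0 ∉ s) : ∃ r, shift 1 r = s :=
  exists_shift_eq fun _ hx ↦ Nat.one_le_iff_ne_zero.2 (ne_of_mem_of_not_mem hx h)

/-- Shift by one and add a zero. -/
def push (s : Finset ℕ) : Finset ℕ := insert 0 (s.shift 1)

theorem zero_mem_push (s : Finset ℕ) : 0 ∈ s.push := mem_insert_self _ _

theorem card_push (s : Finset ℕ) : s.push.card = s.card + 1 := by
  rw [push, card_insert_of_notMem (zero_notMem_shift_one s), card_shift]

theorem sum_push (s : Finset ℕ) : s.push.sum id = s.sum id + s.card := by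
  rw [push, sum_insert (zero_notMem_shift_one s), sum_shift]
  simp

theorem erase_push (s : Finset ℕ) : s.push.erase 0 = s.shift 1 :=
  erase_insert (zero_notMem_shift_one s)

theorem push_injective : Function.Injective push := fun s r h ↦ by
  apply shift_injective 1
  rw [← erase_push, h, erase_push]

theorem exists_push_eq {s : Finset ℕ} (h : 0 ∈ s) : ∃ r, push r = s := by
  obtain ⟨r, hr⟩ := exists_shift_one_eq (notMem_erase 0 s)
  exact ⟨r, by rw [push, hr, insert_erase h]⟩

end Finset

namespace Multiset

/-- The multiset of all `x + k` with `x ∈ s`. -/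
def shift (k : ℕ) (s : Multiset ℕ) : Multiset ℕ := s.map (· + k)

theorem mem_shift {k x : ℕ} {s : Multiset ℕ} : x ∈ s.shift k ↔ ∃ y ∈ s, y + k = x := by
  simp [shift]

theorem card_shift (k : ℕ) (s : Multiset ℕ) : (s.shift k).card = s.card := card_map _ _

theorem sum_shift (k : ℕ) (s : Multiset ℕ) : (s.shift k).sum = s.sum + s.card * k := by
  simp [shift, sum_map_add]

theorem shift_injective (k : ℕ) : Function.Injective (shift k) :=
  map_injective (add_left_injective k)

theorem zero_notMem_shift_one (s : Multiset ℕ) : 0 ∉ s.shift 1 := by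
  simp [mem_shift]

theorem exists_shift_eq {k : ℕ} {s : Multiset ℕ} (h : ∀ x ∈ s, k ≤ x) : ∃ r, shift k r = s := by
  refine ⟨s.map (· - k), ?_⟩
  rw [shift, map_map]
  conv_rhs => rw [← map_id s]
  exact map_congr rfl fun x hx ↦ Nat.sub_add_cancel (h x hx)

theorem exists_shift_one_eq {s : Multiset ℕ} (h : 0 ∉ s) : ∃ r, shift 1 r = s :=
  exists_shift_eq fun _ hx ↦ Nat.one_le_iff_ne_zero.2 (ne_of_mem_of_not_mem hx h)

end Multiset

/-- Pairs of a partition into distinct nonnegative parts and one into nonnegative parts. -/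
def pairSystem : WordSystem (fun _ : Finset ℕ × Multiset ℕ ↦ True) where
  base := (∅, 0)
  op b p := if b then (p.1.push, p.2.shift 1) else (p.1, 0 ::ₘ p.2)
  step p := (p.1.shift 1, p.2.shift 1)
  size p := p.1.card + p.2.card + p.1.sum id + p.2.sum
  base_mem := trivial
  op_mem _ _ _ := trivial
  step_mem _ _ := trivial
  step_base := rfl
  op_inj := by
    rintro (_ | _) (_ | _) ⟨C, D⟩ ⟨C', D'⟩ - - h
    · simpa using h
    · have h₂ : 0 ::ₘ D = D'.shift 1 := congrArg Prod.snd h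
      exact absurd (h₂ ▸ Multiset.mem_cons_self 0 D) D'.zero_notMem_shift_one
    · have h₂ : D.shift 1 = 0 ::ₘ D' := congrArg Prod.snd h
      exact absurd (h₂ ▸ Multiset.mem_cons_self 0 D') D.zero_notMem_shift_one
    · have h₁ : C.push = C'.push := congrArg Prod.fst h
      have h₂ : D.shift 1 = D'.shift 1 := congrArg Prod.snd h
      rw [Finset.push_injective h₁, Multiset.shift_injective 1 h₂]
      exact ⟨rfl, rfl⟩
  step_inj := by
    rintro ⟨C, D⟩ ⟨C', D'⟩ - - h
    have h₁ : C.shift 1 = C'.shift 1 := congrArg Prod.fst h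
    have h₂ : D.shift 1 = D'.shift 1 := congrArg Prod.snd h
    rw [Finset.shift_injective 1 h₁, Multiset.shift_injective 1 h₂]
  op_ne_base := by
    rintro (_ | _) ⟨C, D⟩ - h
    · exact Multiset.cons_ne_zero (congrArg Prod.snd h)
    · exact Finset.ne_empty_of_mem C.zero_mem_push (congrArg Prod.fst h)
  op_ne_step := by
    rintro (_ | _) ⟨C, D⟩ ⟨C', D'⟩ - - h
    · have h₂ : 0 ::ₘ D = D'.shift 1 := congrArg Prod.snd h
      exact absurd (h₂ ▸ Multiset.mem_cons_self 0 D) D'.zero_notMem_shift_one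
    · have h₁ : C.push = C'.shift 1 := congrArg Prod.fst h
      exact absurd (h₁ ▸ C.zero_mem_push) C'.zero_notMem_shift_one
  cases_mem := by
    rintro ⟨C, D⟩ -
    by_cases hD : 0 ∈ D
    · obtain ⟨D, rfl⟩ := Multiset.exists_cons_of_mem hD
      exact Or.inr (Or.inl ⟨false, (C, D), trivial, rfl, by simp⟩)
    obtain ⟨D, rfl⟩ := Multiset.exists_shift_one_eq hD
    by_cases hC : 0 ∈ C
    · obtain ⟨C, rfl⟩ := Finset.exists_push_eq hC
      refine Or.inr (Or.inl ⟨true, (C, D), trivial, rfl, ?_⟩)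
      simp only [Finset.card_push, Finset.sum_push, Multiset.card_shift, Multiset.sum_shift]
      lia
    obtain ⟨C, rfl⟩ := Finset.exists_shift_one_eq hC
    rcases Nat.eq_zero_or_pos (C.card + D.card) with h | h
    · obtain rfl : C = ∅ := Finset.card_eq_zero.1 (by lia)
      obtain rfl : D = 0 := Multiset.card_eq_zero.1 (by lia)
      exact Or.inl rfl
    · refine Or.inr (Or.inr ⟨(C, D), trivial, rfl, ?_⟩)
      simp only [Finset.card_shift, Finset.sum_shift, Multiset.card_shift, Multiset.sum_shift]
      lia

/-- Pairs of a partition into distinct parts and a partition, all parts being less than `n`. -/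
def boxSystem : WordSystem (fun p : ℕ × Finset ℕ × Multiset ℕ ↦
    (∀ x ∈ p.2.1, x < p.1) ∧ ∀ x ∈ p.2.2, x < p.1) where
  base := (0, ∅, 0)
  op b p := (p.1 + 1, if b then insert p.1 p.2.1 else p.2.1, p.2.2)
  step p := (p.1, p.2.1, if p.1 = 0 then p.2.2 else (p.1 - 1) ::ₘ p.2.2)
  size p := p.1 + p.2.2.card
  base_mem := by simp
  op_mem := by
    rintro (_ | _) ⟨n, l, ν⟩ ⟨hl, hν⟩
    · exact ⟨fun x hx ↦ (hl x hx).trans n.lt_succ_self, fun x hx ↦ (hν x hx).trans n.lt_succ_self⟩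
    · refine ⟨fun x hx ↦ ?_, fun x hx ↦ (hν x hx).trans n.lt_succ_self⟩
      obtain rfl | hx := Finset.mem_insert.1 hx
      · exact x.lt_succ_self
      · exact (hl x hx).trans n.lt_succ_self
  step_mem := by
    rintro ⟨n, l, ν⟩ ⟨hl, hν⟩
    refine ⟨hl, fun x hx ↦ ?_⟩
    dsimp only at *
    split_ifs at hx with hn
    · exact hν x hx
    · obtain rfl | hx := Multiset.mem_cons.1 hx
      · lia
      · exact hν x hx
  step_base := rfl
  op_inj := by
    rintro b c ⟨n, l, ν⟩ ⟨n', l', ν'⟩ ⟨hl, -⟩ ⟨hl', -⟩ h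
    simp only [Prod.mk.injEq, Nat.add_right_cancel_iff] at h hl hl'
    obtain ⟨rfl, h, rfl⟩ := h
    have hn : n ∉ l := fun hx ↦ lt_irrefl _ (hl n hx)
    have hn' : n ∉ l' := fun hx ↦ lt_irrefl _ (hl' n hx)
    cases b <;> cases c <;> simp only [Bool.false_eq_true, if_false, if_true] at h
    · simp [h]
    · exact absurd (h ▸ Finset.mem_insert_self n l') hn
    · exact absurd (h ▸ Finset.mem_insert_self n l) hn'
    · rw [← Finset.erase_insert hn, h, Finset.erase_insert hn']
      exact ⟨rfl, rfl⟩
  step_inj := by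
    rintro ⟨n, l, ν⟩ ⟨n', l', ν'⟩ - - h
    simp only [Prod.mk.injEq] at h
    obtain ⟨rfl, rfl, h⟩ := h
    split_ifs at h with hn
    · rw [h]
    · rw [(Multiset.cons_inj_right _).1 h]
  op_ne_base _ _ _ h := Nat.succ_ne_zero _ (congrArg Prod.fst h)
  op_ne_step := by
    rintro b ⟨n, l, ν⟩ ⟨n', l', ν'⟩ ⟨-, hν⟩ - h
    simp only [Prod.mk.injEq] at h
    obtain ⟨rfl, -, h⟩ := h
    rw [if_neg n.succ_ne_zero] at h
    exact lt_irrefl n (hν n (h ▸ Multiset.mem_cons_self n ν'))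
  cases_mem := by
    rintro ⟨n, l, ν⟩ ⟨hl, hν⟩
    dsimp only at hl hν
    cases n with
    | zero =>
      obtain rfl : l = ∅ := Finset.eq_empty_of_forall_notMem fun x hx ↦ Nat.not_lt_zero _ (hl x hx)
      obtain rfl : ν = 0 :=
        Multiset.eq_zero_of_forall_notMem fun x hx ↦ Nat.not_lt_zero _ (hν x hx)
      exact Or.inl rfl
    | succ n =>
      by_cases hn : n ∈ ν
      · obtain ⟨ν, rfl⟩ := Multiset.exists_cons_of_mem hn
        exact Or.inr (Or.inr ⟨(n + 1, l, ν), ⟨hl, fun x hx ↦ hν x (Multiset.mem_cons_of_mem hx)⟩,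
          by simp, by simp⟩)
      have hν' : ∀ x ∈ ν, x < n := fun x hx ↦
        lt_of_le_of_ne (Nat.lt_succ_iff.1 (hν x hx)) (ne_of_mem_of_not_mem hx hn)
      by_cases hn : n ∈ l
      · refine Or.inr (Or.inl ⟨true, (n, l.erase n, ν), ⟨fun x hx ↦ ?_, hν'⟩, ?_, by simp⟩)
        · exact lt_of_le_of_ne (Nat.lt_succ_iff.1 (hl x (Finset.mem_of_mem_erase hx)))
            (Finset.ne_of_mem_erase hx)
        · simp [Finset.insert_erase hn]
      · exact Or.inr (Or.inl ⟨false, (n, l, ν), ⟨fun x hx ↦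
          lt_of_le_of_ne (Nat.lt_succ_iff.1 (hl x hx)) (ne_of_mem_of_not_mem hx hn), hν'⟩,
          rfl, by simp⟩)

/-- Pairs of partitions into distinct nonnegative parts, the parts of the second one being less
than the number of parts of the first one. -/
def subsetSystem : WordSystem (fun p : Finset ℕ × Finset ℕ ↦ ∀ x ∈ p.2, x < p.1.card) where
  base := (∅, ∅)
  op b p := (p.1.push, if b then p.2.shift 1 else p.2.push)
  step p := (p.1.shift 1, p.2)
  size p := p.1.card + p.1.sum id
  base_mem := by simp
  op_mem := by
    rintro b ⟨γ, l⟩ h x hx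
    rw [Finset.card_push]
    have hx : x = 0 ∨ ∃ y ∈ l, y + 1 = x := by
      cases b
      · exact (Finset.mem_insert.1 hx).imp id Finset.mem_shift.1
      · exact Or.inr (Finset.mem_shift.1 hx)
    obtain rfl | ⟨y, hy, rfl⟩ := hx
    · exact Nat.succ_pos _
    · exact Nat.succ_lt_succ (h y hy)
  step_mem p h x hx := by
    rw [Finset.card_shift]
    exact h x hx
  step_base := rfl
  op_inj := by
    rintro b c ⟨γ, l⟩ ⟨γ', l'⟩ - - h
    simp only [Prod.mk.injEq] at h
    obtain ⟨h₁, h₂⟩ := h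
    cases b <;> cases c <;> simp only [Bool.false_eq_true, if_false, if_true] at h₂
    · rw [Finset.push_injective h₁, Finset.push_injective h₂]
      exact ⟨rfl, rfl⟩
    · exact absurd (h₂ ▸ l.zero_mem_push) l'.zero_notMem_shift_one
    · exact absurd (h₂ ▸ l'.zero_mem_push) l.zero_notMem_shift_one
    · rw [Finset.push_injective h₁, Finset.shift_injective 1 h₂]
      exact ⟨rfl, rfl⟩
  step_inj := by
    rintro ⟨γ, l⟩ ⟨γ', l'⟩ - - h
    simp only [Prod.mk.injEq] at h
    rw [Finset.shift_injective 1 h.1, h.2]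
  op_ne_base b p _ h := Finset.ne_empty_of_mem p.1.zero_mem_push (congrArg Prod.fst h)
  op_ne_step := by
    rintro b ⟨γ, l⟩ ⟨γ', l'⟩ - - h
    have h₁ : γ.push = γ'.shift 1 := congrArg Prod.fst h
    exact absurd (h₁ ▸ γ.zero_mem_push) γ'.zero_notMem_shift_one
  cases_mem := by
    rintro ⟨γ, l⟩ h
    dsimp only at h
    by_cases hγ : 0 ∈ γ
    · obtain ⟨γ, rfl⟩ := Finset.exists_push_eq hγ
      rw [Finset.card_push] at h
      by_cases hl : 0 ∈ l
      · obtain ⟨l, rfl⟩ := Finset.exists_push_eq hl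
        refine Or.inr (Or.inl ⟨false, (γ, l), fun x hx ↦ ?_, rfl, ?_⟩)
        · exact Nat.lt_of_succ_lt_succ
            (h (x + 1) (Finset.mem_insert_of_mem (Finset.mem_shift.2 ⟨x, hx, rfl⟩)))
        · simp only [Finset.card_push, Finset.sum_push]
          lia
      · obtain ⟨l, rfl⟩ := Finset.exists_shift_one_eq hl
        refine Or.inr (Or.inl ⟨true, (γ, l), fun x hx ↦ ?_, rfl, ?_⟩)
        · exact Nat.lt_of_succ_lt_succ (h (x + 1) (Finset.mem_shift.2 ⟨x, hx, rfl⟩))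
        · simp only [Finset.card_push, Finset.sum_push]
          lia
    obtain ⟨γ, rfl⟩ := Finset.exists_shift_one_eq hγ
    rw [Finset.card_shift] at h
    rcases Nat.eq_zero_or_pos γ.card with hc | hc
    · obtain rfl : γ = ∅ := Finset.card_eq_zero.1 hc
      obtain rfl : l = ∅ := Finset.eq_empty_of_forall_notMem fun x hx ↦ Nat.not_lt_zero _ (h x hx)
      exact Or.inl rfl
    · refine Or.inr (Or.inr ⟨(γ, l), h, rfl, ?_⟩)
      simp only [Finset.card_shift, Finset.sum_shift]
      lia

/-- The bijection behind the `q`-binomial theorem. -/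
theorem exists_equiv_pair_box :
    ∃ e : {_p : Finset ℕ × Multiset ℕ // True} ≃ {p : ℕ × Finset ℕ × Multiset ℕ //
        (∀ x ∈ p.2.1, x < p.1) ∧ ∀ x ∈ p.2.2, x < p.1},
      ∀ p : {_p : Finset ℕ × Multiset ℕ // True},
        (e p).1.1 = p.1.1.card + p.1.2.card ∧ (e p).1.2.1.card = p.1.1.card ∧
        (e p).1.2.1.sum id + (e p).1.2.2.sum + (e p).1.2.2.card = p.1.1.sum id + p.1.2.sum := by
  refine pairSystem.exists_equiv boxSystem (fun p q ↦ q.1 = p.1.card + p.2.card ∧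
    q.2.1.card = p.1.card ∧ q.2.1.sum id + q.2.2.sum + q.2.2.card = p.1.sum id + p.2.sum)
    (by simp [pairSystem, boxSystem]) ?_ ?_
  · rintro (_ | _) ⟨C, D⟩ ⟨n, l, ν⟩ - ⟨hl, -⟩ h
    · simp [pairSystem, boxSystem] at h ⊢
      lia
    · have hn : n ∉ l := fun hx ↦ lt_irrefl _ (hl n hx)
      have hs : (insert n l).sum id = n + l.sum id := Finset.sum_insert hn
      simp only [pairSystem, boxSystem, if_true, Finset.card_push, Finset.sum_push,
        Multiset.card_shift, Multiset.sum_shift, Finset.card_insert_of_notMem hn, hs] at h ⊢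
      lia
  · rintro ⟨C, D⟩ ⟨n, l, ν⟩ - - h
    simp only [pairSystem, boxSystem, Finset.card_shift, Finset.sum_shift,
        Multiset.card_shift, Multiset.sum_shift] at h ⊢
    split_ifs
    · lia
    · simp only [Multiset.sum_cons, Multiset.card_cons]
      lia

/-- The bijection behind `qᵐ⁽ᵐ⁻¹⁾ᐟ² / (q)ₘ · [m, j] = qᵐ⁽ᵐ⁻¹⁾ᐟ² / ((q)ⱼ (q)ₘ₋ⱼ)`. -/
theorem exists_equiv_subset_pair :
    ∃ e : {p : Finset ℕ × Finset ℕ // ∀ x ∈ p.2, x < p.1.card} ≃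
        {_p : Finset ℕ × Multiset ℕ // True},
      ∀ p : {p : Finset ℕ × Finset ℕ // ∀ x ∈ p.2, x < p.1.card},
        p.1.1.card = (e p).1.1.card + (e p).1.2.card ∧ p.1.2.card = (e p).1.2.card ∧
        p.1.1.sum id + p.1.2.sum id + (e p).1.2.card = (e p).1.1.sum id + (e p).1.2.sum
          + (e p).1.2.card * ((e p).1.1.card + (e p).1.2.card) := by
  refine subsetSystem.exists_equiv pairSystem (fun p q ↦ p.1.card = q.1.card + q.2.card ∧
    p.2.card = q.2.card ∧ p.1.sum id + p.2.sum id + q.2.card = q.1.sum id + q.2.sum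
      + q.2.card * (q.1.card + q.2.card)) (by simp [pairSystem, subsetSystem]) ?_ ?_
  · rintro (_ | _) ⟨γ, l⟩ ⟨A, δ⟩ - - ⟨h₁, h₂, h₃⟩
    · simp [pairSystem, subsetSystem, Finset.card_push, Finset.sum_push,
        -id_eq] at h₁ h₂ h₃ ⊢
      exact ⟨by lia, h₂, by linarith⟩
    · simp [pairSystem, subsetSystem, Finset.card_push, Finset.sum_push, Finset.card_shift,
        Finset.sum_shift, Multiset.card_shift, Multiset.sum_shift, -id_eq] at h₁ h₂ h₃ ⊢
      exact ⟨by lia, h₂, by linarith⟩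
  · rintro ⟨γ, l⟩ ⟨A, δ⟩ - - ⟨h₁, h₂, h₃⟩
    simp only [pairSystem, subsetSystem, Finset.card_shift, Finset.sum_shift,
      Multiset.card_shift, Multiset.sum_shift] at h₁ h₂ h₃ ⊢
    exact ⟨h₁, h₂, by linarith⟩

/-- The Durfee rectangle decomposition: `B` has a `j × (K + j - 1)` rectangle. -/
theorem exists_durfee (K : ℕ) (B : Multiset ℕ) :
    ∃ p μ : Multiset ℕ, p + μ = B ∧ (∀ x ∈ p, K + p.card ≤ x + 1) ∧ ∀ x ∈ μ, x < K + p.card := by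
  induction B using Multiset.induction_on with
  | empty => exact ⟨0, 0, by simp⟩
  | cons b B ih =>
    obtain ⟨p, μ, rfl, hp, hμ⟩ := ih
    by_cases hb : b < K + p.card
    · refine ⟨p, b ::ₘ μ, Multiset.add_cons _ _ _, hp, fun x hx ↦ ?_⟩
      obtain rfl | hx := Multiset.mem_cons.1 hx
      exacts [hb, hμ x hx]
    by_cases h : ∀ x ∈ p, K + p.card ≤ x
    · refine ⟨b ::ₘ p, μ, Multiset.cons_add _ _ _, fun x hx ↦ ?_, fun x hx ↦ ?_⟩
      · rw [Multiset.card_cons]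
        obtain rfl | hx := Multiset.mem_cons.1 hx
        · lia
        · have := h x hx
          lia
      · rw [Multiset.card_cons]
        have := hμ x hx
        lia
    · push Not at h
      obtain ⟨y, hy, hyp⟩ := h
      obtain ⟨p, rfl⟩ := Multiset.exists_cons_of_mem hy
      refine ⟨b ::ₘ p, y ::ₘ μ, ?_, fun x hx ↦ ?_, fun x hx ↦ ?_⟩
      · simp only [Multiset.cons_add, Multiset.add_cons, Multiset.cons_swap]
      · rw [Multiset.card_cons] at *
        obtain rfl | hx := Multiset.mem_cons.1 hx
        · lia
        · exact hp x (Multiset.mem_cons_of_mem hx)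
      · rw [Multiset.card_cons] at *
        obtain rfl | hx := Multiset.mem_cons.1 hx
        exacts [hyp, hμ x hx]

theorem durfee_card_le {K : ℕ} {p μ p' μ' : Multiset ℕ} (h : p + μ = p' + μ')
    (hμ : ∀ x ∈ μ, x < K + p.card) (hp' : ∀ x ∈ p', K + p'.card ≤ x + 1) :
    p'.card ≤ p.card := by
  by_contra! hlt
  have h₁ : p'.countP (K + p.card ≤ ·) = p'.card :=
    Multiset.countP_eq_card.2 fun x hx ↦ by have := hp' x hx; lia
  have h₂ : μ.countP (K + p.card ≤ ·) = 0 :=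
    Multiset.countP_eq_zero.2 fun x hx ↦ not_le.2 (hμ x hx)
  have h₃ := congrArg (Multiset.countP (K + p.card ≤ ·)) h
  rw [Multiset.countP_add, Multiset.countP_add, h₁, h₂] at h₃
  have := Multiset.countP_le_card (K + p.card ≤ ·) p
  lia

theorem durfee_unique {K : ℕ} {p μ p' μ' : Multiset ℕ} (h : p + μ = p' + μ')
    (hp : ∀ x ∈ p, K + p.card ≤ x + 1) (hμ : ∀ x ∈ μ, x < K + p.card)
    (hp' : ∀ x ∈ p', K + p'.card ≤ x + 1) (hμ' : ∀ x ∈ μ', x < K + p'.card) :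
    p = p' ∧ μ = μ' := by
  have hc : p.card = p'.card :=
    le_antisymm (durfee_card_le h.symm hμ' hp) (durfee_card_le h hμ hp')
  rw [← hc] at hp' hμ'
  generalize hT : K + p.card = T at *
  have key : ∀ q : Multiset ℕ, (∀ x ∈ q, T ≤ x + 1) →
      q = q.filter (T ≤ ·) + Multiset.replicate (q.card - (q.filter (T ≤ ·)).card) (T - 1) := by
    intro q hq
    have h₁ := Multiset.filter_add_not (T ≤ ·) q
    have h₂ : q.filter (fun x ↦ ¬ T ≤ x) =
        Multiset.replicate (q.card - (q.filter (T ≤ ·)).card) (T - 1) := by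
      refine Multiset.eq_replicate.2 ⟨?_, fun x hx ↦ ?_⟩
      · have := congrArg Multiset.card h₁
        rw [Multiset.card_add] at this
        lia
      · obtain ⟨hx, hxT⟩ := Multiset.mem_filter.1 hx
        have := hq x hx
        lia
    rw [← h₂, h₁]
  have hf : ∀ ν : Multiset ℕ, (∀ x ∈ ν, x < T) → ν.filter (T ≤ ·) = 0 := fun ν hν ↦
    Multiset.filter_eq_nil.2 fun x hx ↦ not_le.2 (hν x hx)
  have h₃ := congrArg (Multiset.filter (T ≤ ·)) h
  rw [Multiset.filter_add, Multiset.filter_add, hf μ hμ, hf μ' hμ', add_zero, add_zero] at h₃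
  obtain rfl : p = p' := by rw [key p hp, key p' hp', h₃, hc]
  exact ⟨rfl, add_left_cancel h⟩

theorem Finset.disjoint_shift {N : ℕ} {κ : Finset ℕ} (h : ∀ x ∈ κ, x < N) (l : Finset ℕ) :
    Disjoint κ (l.shift N) := by
  refine Finset.disjoint_left.2 fun x hx hx' ↦ ?_
  obtain ⟨y, -, rfl⟩ := Finset.mem_shift.1 hx'
  have := h _ hx
  lia

theorem Finset.union_shift_inj {N : ℕ} {κ κ' l l' : Finset ℕ} (hκ : ∀ x ∈ κ, x < N)
    (hκ' : ∀ x ∈ κ', x < N) (h : κ ∪ l.shift N = κ' ∪ l'.shift N) : κ = κ' ∧ l = l' := by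
  have key : ∀ {κ l : Finset ℕ}, (∀ x ∈ κ, x < N) →
      (κ ∪ l.shift N).filter (· < N) = κ := by
    intro κ l hκ
    ext x
    simp only [mem_filter, mem_union, mem_shift]
    constructor
    · rintro ⟨hx | ⟨y, -, rfl⟩, hlt⟩
      · exact hx
      · lia
    · exact fun hx ↦ ⟨Or.inl hx, hκ x hx⟩
  obtain rfl : κ = κ' := by rw [← key (l := l) hκ, h, key hκ']
  refine ⟨rfl, shift_injective N ?_⟩
  rw [← Finset.union_sdiff_cancel_left (disjoint_shift hκ l), h,
    Finset.union_sdiff_cancel_left (disjoint_shift hκ l')]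

theorem Finset.exists_union_shift_eq {N M : ℕ} {s : Finset ℕ} (h : ∀ x ∈ s, x < N + M) :
    ∃ κ l : Finset ℕ, (∀ x ∈ κ, x < N) ∧ (∀ x ∈ l, x < M) ∧ κ ∪ l.shift N = s := by
  obtain ⟨l, hl⟩ := exists_shift_eq (k := N) (s := s.filter (N ≤ ·)) (by simp)
  refine ⟨s.filter (· < N), l, by simp, fun x hx ↦ ?_, ?_⟩
  · have hx' : x + N ∈ s.filter (N ≤ ·) := hl ▸ mem_shift.2 ⟨x, hx, rfl⟩
    have := h _ (mem_filter.1 hx').1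
    lia
  · rw [hl]
    ext x
    simp only [mem_union, mem_filter, ← and_or_left, lt_or_ge, and_true]

/-- Triples `(γ, λ, μ)` where `γ` and `λ` have distinct parts and the parts of `λ` and `μ` are
less than `N + l(γ)`. -/
abbrev BoundedTriple (N : ℕ) : Type :=
  {p : Finset ℕ × Finset ℕ × Multiset ℕ //
    (∀ x ∈ p.2.1, x < N + p.1.card) ∧ ∀ x ∈ p.2.2, x < N + p.1.card}

theorem exists_equiv_of_bijective {P X Y : Type} {g : P → X} {f : P → Y}
    (hg : Function.Bijective g) (hf : Function.Bijective f) (R : X → Y → Prop)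
    (h : ∀ p, R (g p) (f p)) : ∃ e : X ≃ Y, ∀ x, R x (e x) := by
  refine ⟨(Equiv.ofBijective g hg).symm.trans (Equiv.ofBijective f hf), fun x ↦ ?_⟩
  obtain ⟨p, rfl⟩ := hg.surjective x
  have : (Equiv.ofBijective g hg).symm (g p) = p := (Equiv.ofBijective g hg).symm_apply_apply p
  rw [Equiv.trans_apply, this]
  exact h p

/-- The bijection behind
`∑ₘ qᵐ⁽ᵐ⁻¹⁾ᐟ² (b/a)ᵐ (-a)_{N+m} / ((q)ₘ (b)_{N+m}) = (-b/a)_∞ (-a)_N / (b)_∞`. -/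
theorem exists_equiv_boundedTriple (N : ℕ) :
    ∃ e : BoundedTriple N ≃ (Finset ℕ × Multiset ℕ) × {κ : Finset ℕ // ∀ x ∈ κ, x < N},
      ∀ p : BoundedTriple N,
        p.1.1.sum id + p.1.2.1.sum id + p.1.2.2.sum
          = (e p).1.1.sum id + (e p).1.2.sum + (e p).2.1.sum id ∧
        p.1.2.1.card + (e p).1.1.card = (e p).2.1.card + p.1.1.card ∧
        p.1.1.card + p.1.2.2.card = (e p).1.1.card + (e p).1.2.card := by
  obtain ⟨e, he⟩ := exists_equiv_subset_pair
  let P : Type := {z : {p : Finset ℕ × Finset ℕ // ∀ x ∈ p.2, x < p.1.card} ×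
    {κ : Finset ℕ // ∀ x ∈ κ, x < N} × Multiset ℕ // ∀ x ∈ z.2.2, x < N + z.1.1.1.card}
  let g : P → BoundedTriple N := fun z ↦
    ⟨(z.1.1.1.1, z.1.2.1.1 ∪ z.1.1.1.2.shift N, z.1.2.2), fun x hx ↦ by
      obtain hx | hx := Finset.mem_union.1 hx
      · exact (z.1.2.1.2 x hx).trans_le (Nat.le_add_right _ _)
      · obtain ⟨y, hy, rfl⟩ := Finset.mem_shift.1 hx
        have := z.1.1.2 y hy
        dsimp only
        lia, z.2⟩
  let f : P → (Finset ℕ × Multiset ℕ) × {κ : Finset ℕ // ∀ x ∈ κ, x < N} := fun z ↦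
    (((e z.1.1).1.1,
      (e z.1.1).1.2.shift (N + (e z.1.1).1.1.card + (e z.1.1).1.2.card - 1) + z.1.2.2), z.1.2.1)
  have h_shift : ∀ (K : ℕ) (δ : Multiset ℕ), ∀ x ∈ δ.shift (K + δ.card - 1), K + δ.card ≤ x + 1 := by
    intro K δ x hx
    obtain ⟨y, -, rfl⟩ := Multiset.mem_shift.1 hx
    lia
  refine exists_equiv_of_bijective (g := g) (f := f) ⟨?_, ?_⟩ ⟨?_, ?_⟩ (fun p q ↦
    p.1.1.sum id + p.1.2.1.sum id + p.1.2.2.sum = q.1.1.sum id + q.1.2.sum + q.2.1.sum id ∧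
    p.1.2.1.card + q.1.1.card = q.2.1.card + p.1.1.card ∧
    p.1.1.card + p.1.2.2.card = q.1.1.card + q.1.2.card) ?_
  · rintro ⟨⟨⟨⟨γ, l⟩, hl⟩, ⟨κ, hκ⟩, μ⟩, hμ⟩ ⟨⟨⟨⟨γ', l'⟩, hl'⟩, ⟨κ', hκ'⟩, μ'⟩, hμ'⟩ h
    simp only [g, Subtype.mk.injEq, Prod.mk.injEq] at h
    obtain ⟨rfl, h, rfl⟩ := h
    obtain ⟨rfl, rfl⟩ := Finset.union_shift_inj hκ hκ' h
    rfl
  · rintro ⟨⟨γ, l, μ⟩, hl, hμ⟩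
    obtain ⟨κ, l, hκ, hl', rfl⟩ := Finset.exists_union_shift_eq hl
    exact ⟨⟨(⟨(γ, l), hl'⟩, ⟨κ, hκ⟩, μ), hμ⟩, rfl⟩
  · rintro ⟨⟨s, κ, μ⟩, hμ⟩ ⟨⟨s', κ', μ'⟩, hμ'⟩ h
    obtain ⟨⟨⟨A, δ⟩, ht⟩, rfl⟩ := e.symm.surjective s
    obtain ⟨⟨⟨A', δ'⟩, ht'⟩, rfl⟩ := e.symm.surjective s'
    have hs := (he (e.symm ⟨⟨A, δ⟩, ht⟩)).1
    have hs' := (he (e.symm ⟨⟨A', δ'⟩, ht'⟩)).1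
    simp only [Equiv.apply_symm_apply] at hs hs'
    simp only [f, Prod.mk.injEq, Equiv.apply_symm_apply] at h
    obtain ⟨⟨rfl, h⟩, rfl⟩ := h
    simp only [hs, ← add_assoc] at hμ
    simp only [hs', ← add_assoc] at hμ'
    obtain ⟨h₁, rfl⟩ := durfee_unique (K := N + A.card) h
      (by rw [Multiset.card_shift]; exact h_shift _ δ) (by rwa [Multiset.card_shift])
      (by rw [Multiset.card_shift]; exact h_shift _ δ') (by rwa [Multiset.card_shift])
    have hc : δ.card = δ'.card := by
      simpa only [Multiset.card_shift] using congrArg Multiset.card h₁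
    rw [hc] at h₁
    obtain rfl := Multiset.shift_injective _ h₁
    rfl
  · rintro ⟨⟨A, B⟩, κ⟩
    obtain ⟨p, μ, rfl, hp, hμ⟩ := exists_durfee (N + A.card) B
    obtain ⟨δ, hδ⟩ := Multiset.exists_shift_eq (k := N + A.card + p.card - 1) (s := p)
      fun x hx ↦ by have := hp x hx; lia
    have hc : δ.card = p.card := by rw [← hδ, Multiset.card_shift]
    have hs := (he (e.symm ⟨(A, δ), trivial⟩)).1
    rw [Equiv.apply_symm_apply] at hs
    refine ⟨⟨(e.symm ⟨(A, δ), trivial⟩, κ, μ), fun x hx ↦ ?_⟩, ?_⟩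
    · rw [hs, hc, ← add_assoc]
      exact hμ x hx
    · simp only [f, Equiv.apply_symm_apply, hc, hδ]
  · rintro ⟨⟨s, ⟨κ, hκ⟩, μ⟩, hμ⟩
    obtain ⟨h₁, h₂, h₃⟩ := he s
    have hd := Finset.disjoint_shift hκ s.1.2
    have hj : (e s).1.2.card * (N + (e s).1.1.card + (e s).1.2.card - 1) + (e s).1.2.card =
        (e s).1.2.card * (N + (e s).1.1.card + (e s).1.2.card) := by
      rcases Nat.eq_zero_or_pos (e s).1.2.card with h | h
      · simp [h]
      · rw [← Nat.mul_succ]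
        congr 1
        lia
    have hu : (κ ∪ s.1.2.shift N).sum id = κ.sum id + (s.1.2.shift N).sum id :=
      Finset.sum_union hd
    simp only [f, g, hu, Finset.card_union_of_disjoint hd, Finset.card_shift, Finset.sum_shift,
      Multiset.sum_add, Multiset.card_add, Multiset.card_shift, Multiset.sum_shift]
    rw [h₂]
    exact ⟨by linarith, by lia, by lia⟩

/-- A tuple in `𝒜` amounts to a pair `(α - 1, β - 1)` and a triple `(γ, λ, μ)`. -/
theorem bijective_tupleA (N : ℕ) : Function.Bijective
    (fun z : (Finset ℕ × Multiset ℕ) × BoundedTriple N ↦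
      ({ n := N + z.2.1.1.card, α := z.1.1.shift 1, β := z.1.2.shift 1, γ := z.2.1.1,
         lam := z.2.1.2.1, μ := z.2.1.2.2
         hα := fun _ hx ↦ Nat.pos_of_ne_zero (ne_of_mem_of_not_mem hx z.1.1.zero_notMem_shift_one)
         hβ := fun _ hx ↦ Nat.pos_of_ne_zero (ne_of_mem_of_not_mem hx z.1.2.zero_notMem_shift_one)
         hlam := z.2.2.1, hμ := z.2.2.2, hN := by push_cast; ring } : RamanujanTupleA N)) := by
  constructor
  · rintro ⟨⟨A, B⟩, ⟨γ, l, μ⟩, h⟩ ⟨⟨A', B'⟩, ⟨γ', l', μ'⟩, h'⟩ H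
    simp only [RamanujanTupleA.mk.injEq] at H
    obtain ⟨-, h₁, h₂, rfl, rfl, rfl⟩ := H
    obtain rfl := Finset.shift_injective 1 h₁
    obtain rfl := Multiset.shift_injective 1 h₂
    rfl
  · rintro ⟨n, α, β, γ, l, μ, hα, hβ, hl, hμ, hN⟩
    obtain ⟨A, rfl⟩ := Finset.exists_shift_eq hα
    obtain ⟨B, rfl⟩ := Multiset.exists_shift_eq hβ
    obtain rfl : n = N + γ.card := by lia
    exact ⟨((A, B), ⟨(γ, l, μ), hl, hμ⟩), rfl⟩

/-- A tuple in `ℬ` amounts to the pair `(A, B)` and a triple, obtained from `E - 1` and the image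
of `(C, D)` under the bijection behind the `q`-binomial theorem. -/
theorem exists_equiv_tupleB (N : ℕ) :
    ∃ e : (Finset ℕ × Multiset ℕ) × BoundedTriple N ≃ RamanujanTupleB N,
      ∀ z : (Finset ℕ × Multiset ℕ) × BoundedTriple N,
        (e z).A = z.1.1 ∧ (e z).B = z.1.2 ∧ (e z).C.card = z.2.1.2.1.card ∧
        (e z).E.card = z.2.1.1.card ∧
        (e z).C.sum id + (e z).D.sum + (e z).E.sum id = z.2.1.1.sum id + z.2.1.2.1.sum id
          + z.2.1.2.2.sum + z.2.1.1.card + z.2.1.2.2.card := by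
  obtain ⟨e, he⟩ := exists_equiv_pair_box
  have hcard : ∀ z : BoundedTriple N, (e.symm ⟨(N + z.1.1.card, z.1.2), z.2⟩).1.1.card +
      (e.symm ⟨(N + z.1.1.card, z.1.2), z.2⟩).1.2.card = N + z.1.1.card := by
    intro z
    have h := (he (e.symm ⟨(N + z.1.1.card, z.1.2), z.2⟩)).1
    rw [Equiv.apply_symm_apply] at h
    exact h.symm
  let f : (Finset ℕ × Multiset ℕ) × BoundedTriple N → RamanujanTupleB N := fun z ↦
    { A := z.1.1
      B := z.1.2
      C := (e.symm ⟨(N + z.2.1.1.card, z.2.1.2), z.2.2⟩).1.1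
      D := (e.symm ⟨(N + z.2.1.1.card, z.2.1.2), z.2.2⟩).1.2
      E := z.2.1.1.shift 1
      hE := fun _ hx ↦
        Nat.pos_of_ne_zero (ne_of_mem_of_not_mem hx z.2.1.1.zero_notMem_shift_one)
      hN := by
        have := hcard z.2
        rw [Finset.card_shift]
        lia }
  have hf : Function.Bijective f := by
    constructor
    · rintro ⟨⟨A, B⟩, ⟨γ, p⟩, h⟩ ⟨⟨A', B'⟩, ⟨γ', p'⟩, h'⟩ H
      simp only [f, RamanujanTupleB.mk.injEq] at H
      obtain ⟨rfl, rfl, h₁, h₂, h₃⟩ := H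
      obtain rfl := Finset.shift_injective 1 h₃
      have h₄ := e.symm.injective (Subtype.ext (Prod.ext h₁ h₂))
      simp only [Subtype.mk.injEq, Prod.mk.injEq, true_and] at h₄
      subst h₄
      rfl
    · rintro ⟨A, B, C, D, E, hE, hN⟩
      obtain ⟨γ, rfl⟩ := Finset.exists_shift_eq hE
      rw [Finset.card_shift] at hN
      have h₁ := (he ⟨(C, D), trivial⟩).1
      have h₂ : C.card + D.card = N + γ.card := by lia
      obtain ⟨⟨⟨n, p⟩, hp⟩, hq⟩ : ∃ q, e ⟨(C, D), trivial⟩ = q := ⟨_, rfl⟩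
      rw [hq] at h₁
      obtain rfl : n = N + γ.card := h₁.trans h₂
      refine ⟨((A, B), ⟨(γ, p), hp⟩), ?_⟩
      have h₃ : e.symm ⟨(N + γ.card, p), hp⟩ = ⟨(C, D), trivial⟩ := by
        rw [← hq, Equiv.symm_apply_apply]
      simp only [f, h₃]
  refine ⟨Equiv.ofBijective f hf, fun z ↦ ⟨rfl, rfl, ?_, Finset.card_shift _ _, ?_⟩⟩
  · have h := (he (e.symm ⟨(N + z.2.1.1.card, z.2.1.2), z.2.2⟩)).2.1
    rw [Equiv.apply_symm_apply] at h
    exact h.symm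
  · have h := (he (e.symm ⟨(N + z.2.1.1.card, z.2.1.2), z.2.2⟩)).2.2
    rw [Equiv.apply_symm_apply] at h
    simp only [Equiv.ofBijective_apply, f, Finset.sum_shift] at h ⊢
    lia

/-- For each integer `N ≥ 0` there is a bijection from `𝒜` to `ℬ` preserving the total
weight, the statistic `l(λ) - l(α) - l(γ) = l(C) - l(A) - l(E)` (the exponent of `a`),
and the statistic `l(γ) + l(μ) = l(A) + l(B)` (the exponent of `b`). -/
theorem ramanujan_onePsiOne_nonneg_coefficient (N : ℤ) (hN : 0 ≤ N) :
    ∃ e : RamanujanTupleA N ≃ RamanujanTupleB N,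
      ∀ p : RamanujanTupleA N,
        (p.α.sum id + p.β.sum + p.γ.sum id + p.lam.sum id + p.μ.sum
          = (e p).A.sum id + (e p).B.sum + (e p).C.sum id + (e p).D.sum + (e p).E.sum id) ∧
        ((p.lam.card : ℤ) - p.α.card - p.γ.card
          = ((e p).C.card : ℤ) - (e p).A.card - (e p).E.card) ∧
        (p.γ.card + p.μ.card = (e p).A.card + (e p).B.card) := by
  lift N to ℕ using hN
  obtain ⟨Φ, hΦ⟩ := exists_equiv_boundedTriple N
  obtain ⟨g, hg⟩ := exists_equiv_tupleB N
  let swap : (Finset ℕ × Multiset ℕ) × BoundedTriple N ≃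
      (Finset ℕ × Multiset ℕ) × BoundedTriple N :=
    { toFun z := ((Φ z.2).1, Φ.symm (z.1, (Φ z.2).2))
      invFun z := ((Φ z.2).1, Φ.symm (z.1, (Φ z.2).2))
      left_inv z := by simp
      right_inv z := by simp }
  refine exists_equiv_of_bijective (bijective_tupleA N) (swap.trans g).bijective (fun p q ↦
    (p.α.sum id + p.β.sum + p.γ.sum id + p.lam.sum id + p.μ.sum
      = q.A.sum id + q.B.sum + q.C.sum id + q.D.sum + q.E.sum id) ∧
    ((p.lam.card : ℤ) - p.α.card - p.γ.card = (q.C.card : ℤ) - q.A.card - q.E.card) ∧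
    (p.γ.card + p.μ.card = q.A.card + q.B.card)) fun z ↦ ?_
  obtain ⟨h₁, h₂, h₃, h₄, h₅⟩ := hg (swap z)
  obtain ⟨k₁, k₂, k₃⟩ := hΦ z.2
  obtain ⟨l₁, l₂, l₃⟩ := hΦ (swap z).2
  have hs : Φ (swap z).2 = (z.1, (Φ z.2).2) := Φ.apply_symm_apply _
  have hs₁ : (swap z).1 = (Φ z.2).1 := rfl
  rw [hs] at l₁ l₂ l₃
  rw [hs₁] at h₁ h₂
  simp only [Equiv.trans_apply, h₁, h₂, h₃, h₄, Finset.card_shift, Finset.sum_shift,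
    Multiset.sum_shift]
  refine ⟨?_, ?_, k₃⟩ <;> lia
end
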